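/- arXiv:2106.08683 — 6 statements merged into one kernel-verified Lean document; each statement's English description precedes it below -/
import Mathlib

section
/- The map Φ from Sym2(ℙ¹(ℂ)) to the dual projective plane sending the unordered pair of [a:b] and [c:d] to the point [bd : −(ad+bc) : ac] is well defined and bijective. Moreover: (i) for all p, q ∈ ℙ¹(ℂ), the line of ℙ² corresponding to Φ({p,q}) passes through ν(p) and ν(q), where ν is the Veronese embedding; and (ii) Φ({p,q}) lies on the dual conic {[α:β:γ] : β² = 4αγ} if and only if p = q. (This realizes the natural isomorphism (ℙ¹)⁽²⁾ ≅ (ℙ²)* identifying an unordered pair of points of a smooth plane conic with the line joining them, tangent lines corresponding to doubled points.) -/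
noncomputable section

/-- `ℙ¹(ℂ)`, the projectivization of `ℂ²`. -/
abbrev ProjLine : Type := Projectivization ℂ (Fin 2 → ℂ)

/-- The dual projective plane `(ℙ²)*`, the projectivization of `ℂ³`: a point
`[α:β:γ]` corresponds to the line `{[x:y:z] : αx + βy + γz = 0} ⊂ ℙ²`. -/
abbrev DualProjPlane : Type := Projectivization ℂ (Fin 3 → ℂ)

/-- The bilinear lift of the map to coordinate vectors. -/
def bil (v w : Fin 2 → ℂ) : Fin 3 → ℂ :=
  ![v 1 * w 1, -(v 0 * w 1 + v 1 * w 0), v 0 * w 0]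

lemma vec2_ne {v : Fin 2 → ℂ} (hv : v ≠ 0) : v 0 ≠ 0 ∨ v 1 ≠ 0 := by
  by_contra! h
  apply hv
  ext i
  fin_cases i
  · exact h.1
  · exact h.2

lemma bil_eq_zero {v w : Fin 2 → ℂ} (hv : v ≠ 0) (h : bil v w = 0) : w = 0 := by
  have h0 : v 1 * w 1 = 0 := congrFun h 0
  have h1 : -(v 0 * w 1 + v 1 * w 0) = 0 := congrFun h 1
  have h2 : v 0 * w 0 = 0 := congrFun h 2
  have key : w 0 = 0 ∧ w 1 = 0 := by
    rcases vec2_ne hv with h | h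
    · have e : w 0 = 0 := by simpa [h] using h2
      rw [e] at h1
      exact ⟨e, by simpa [h] using h1⟩
    · have e : w 1 = 0 := by simpa [h] using h0
      rw [e] at h1
      exact ⟨by simpa [h] using h1, e⟩
  ext i
  fin_cases i
  · exact key.1
  · exact key.2

lemma bil_ne {v w : Fin 2 → ℂ} (hv : v ≠ 0) (hw : w ≠ 0) : bil v w ≠ 0 :=
  fun h => hw (bil_eq_zero hv h)

lemma bil_comm (v w : Fin 2 → ℂ) : bil v w = bil w v := by
  ext i
  fin_cases i <;> simp [bil] <;> ring

lemma bil_smul (s t : ℂ) (v w : Fin 2 → ℂ) : bil (s • v) (t • w) = (s * t) • bil v w := by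
  ext i
  fin_cases i <;> simp [bil] <;> ring

lemma bil_sub (v w u : Fin 2 → ℂ) : bil v (w - u) = bil v w - bil v u := by
  ext i
  fin_cases i <;> simp [bil] <;> ring

lemma mk_eq_of_det {v w : Fin 2 → ℂ} (hv : v ≠ 0) (hw : w ≠ 0)
    (h : v 0 * w 1 - v 1 * w 0 = 0) :
    Projectivization.mk ℂ v hv = Projectivization.mk ℂ w hw := by
  rw [Projectivization.mk_eq_mk_iff']
  rcases vec2_ne hw with h0 | h0
  · refine ⟨v 0 / w 0, ?_⟩
    ext i
    fin_cases i <;> simp <;> field_simp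
    linear_combination h
  · refine ⟨v 1 / w 1, ?_⟩
    ext i
    fin_cases i <;> simp <;> field_simp
    linear_combination -h

/-- The map on the symmetric square. -/
def symMap : Sym2 ProjLine → DualProjPlane :=
  Sym2.lift ⟨fun p q => Projectivization.mk ℂ (bil p.rep q.rep)
    (bil_ne p.rep_nonzero q.rep_nonzero), fun p q => by simp only [bil_comm]⟩

lemma symMap_mk {v w : Fin 2 → ℂ} (hv : v ≠ 0) (hw : w ≠ 0) :
    symMap s(Projectivization.mk ℂ v hv, Projectivization.mk ℂ w hw) =
      Projectivization.mk ℂ (bil v w) (bil_ne hv hw) := by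
  obtain ⟨s, hs⟩ := Projectivization.exists_smul_eq_mk_rep ℂ v hv
  obtain ⟨t, ht⟩ := Projectivization.exists_smul_eq_mk_rep ℂ w hw
  simp only [symMap, Sym2.lift_mk]
  rw [Projectivization.mk_eq_mk_iff']
  refine ⟨s * t, ?_⟩
  rw [← hs, ← ht]
  exact (bil_smul (s : ℂ) (t : ℂ) v w).symm

lemma symMap_rep {v w : Fin 2 → ℂ} (hv : v ≠ 0) (hw : w ≠ 0) :
    ∃ k : ℂ, k ≠ 0 ∧
      (symMap s(Projectivization.mk ℂ v hv, Projectivization.mk ℂ w hw)).rep = k • bil v w := by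
  rw [symMap_mk]
  obtain ⟨s, hs⟩ := Projectivization.exists_smul_eq_mk_rep ℂ _ (bil_ne hv hw)
  exact ⟨s, s.ne_zero, hs.symm⟩

lemma symMap_cancel (p q r : ProjLine) (h : symMap s(p, q) = symMap s(p, r)) : q = r := by
  induction p using Projectivization.ind with | _ v hv
  induction q using Projectivization.ind with | _ w hw
  induction r using Projectivization.ind with | _ u hu
  rw [symMap_mk, symMap_mk, Projectivization.mk_eq_mk_iff'] at h
  obtain ⟨k, hk⟩ := h
  rw [Projectivization.mk_eq_mk_iff']
  refine ⟨k, ?_⟩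
  have h1 : bil v (w - k • u) = 0 := by
    have := bil_smul 1 k v u
    rw [one_smul, one_mul] at this
    rw [bil_sub, this, hk, sub_self]
  exact (sub_eq_zero.mp (bil_eq_zero hv h1)).symm

lemma symMap_mem (p q r t : ProjLine) (h : symMap s(p, q) = symMap s(r, t)) :
    p = r ∨ p = t := by
  induction p using Projectivization.ind with | _ v hv
  induction q using Projectivization.ind with | _ w hw
  induction r using Projectivization.ind with | _ x hx
  induction t using Projectivization.ind with | _ y hy
  rw [symMap_mk, symMap_mk, eq_comm, Projectivization.mk_eq_mk_iff'] at h
  obtain ⟨k, hk⟩ := h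
  have h0 : k * (v 1 * w 1) = x 1 * y 1 := congrFun hk 0
  have h1 : k * (-(v 0 * w 1 + v 1 * w 0)) = -(x 0 * y 1 + x 1 * y 0) := congrFun hk 1
  have h2 : k * (v 0 * w 0) = x 0 * y 0 := congrFun hk 2
  have key : (v 0 * x 1 - v 1 * x 0) * (v 0 * y 1 - v 1 * y 0) = 0 := by
    linear_combination -(v 0) ^ 2 * h0 - v 0 * v 1 * h1 - (v 1) ^ 2 * h2
  rcases mul_eq_zero.mp key with h | h
  · exact Or.inl (mk_eq_of_det hv hx h)
  · exact Or.inr (mk_eq_of_det hv hy h)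

lemma symMap_injective : Function.Injective symMap := by
  intro a b
  induction a using Sym2.ind with | _ p q
  induction b using Sym2.ind with | _ r t
  intro h
  rcases symMap_mem p q r t h with rfl | rfl
  · rw [symMap_cancel _ _ _ h]
  · rw [Sym2.eq_swap (a := r)] at h ⊢
    rw [symMap_cancel _ _ _ h]

lemma symMap_surjective : Function.Surjective symMap := by
  intro P
  induction P using Projectivization.ind with | _ f hf
  suffices H : ∃ v w : Fin 2 → ℂ, bil v w = f by
    obtain ⟨v, w, rfl⟩ := H
    have hv : v ≠ 0 := by
      rintro rfl
      apply hf
      ext i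
      fin_cases i <;> simp [bil]
    have hw : w ≠ 0 := by
      rintro rfl
      apply hf
      ext i
      fin_cases i <;> simp [bil]
    exact ⟨_, symMap_mk hv hw⟩
  by_cases h : f 0 = 0
  · refine ⟨![1, 0], ![f 2, -f 1], ?_⟩
    ext i
    fin_cases i <;> simp [bil, h]
  · obtain ⟨s, hs⟩ := IsAlgClosed.exists_eq_mul_self (discrim (f 0) (f 1) (f 2))
    obtain ⟨r, hr⟩ := exists_quadratic_eq_zero (a := f 0) (b := f 1) (c := f 2) h ⟨s, hs⟩
    refine ⟨![r, 1], ![-f 1 - r * f 0, f 0], ?_⟩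
    ext i
    fin_cases i <;> simp [bil]
    linear_combination -hr

/-- There is a (unique) well-defined map `Φ : Sym2(ℙ¹) → (ℙ²)*` sending the unordered
pair of `[a:b]` and `[c:d]` to `[bd : −(ad+bc) : ac]`; it is bijective; the line of
`ℙ²` corresponding to `Φ({p,q})` passes through the Veronese images
`ν(p) = [a²:ab:b²]` and `ν(q) = [c²:cd:d²]`; and `Φ({p,q})` lies on the dual conic
`β² = 4αγ` if and only if `p = q`. -/
theorem sym2_proj_line_equiv_dual_plane :
    ∃ Φ : Sym2 ProjLine → DualProjPlane,
      -- Φ is well defined by the formula [a:b],[c:d] ↦ [bd : −(ad+bc) : ac]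
      (∀ (a b c d : ℂ) (hab : (![a, b] : Fin 2 → ℂ) ≠ 0)
          (hcd : (![c, d] : Fin 2 → ℂ) ≠ 0)
          (h : (![b * d, -(a * d + b * c), a * c] : Fin 3 → ℂ) ≠ 0),
          Φ s(Projectivization.mk ℂ ![a, b] hab, Projectivization.mk ℂ ![c, d] hcd) =
            Projectivization.mk ℂ ![b * d, -(a * d + b * c), a * c] h) ∧
      -- Φ is bijective
      Function.Bijective Φ ∧
      -- (i) the line corresponding to Φ({p,q}) passes through ν(p) and ν(q)
      (∀ (a b c d : ℂ) (hab : (![a, b] : Fin 2 → ℂ) ≠ 0)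
          (hcd : (![c, d] : Fin 2 → ℂ) ≠ 0),
          (Φ s(Projectivization.mk ℂ ![a, b] hab,
              Projectivization.mk ℂ ![c, d] hcd)).rep 0 * a ^ 2 +
            (Φ s(Projectivization.mk ℂ ![a, b] hab,
              Projectivization.mk ℂ ![c, d] hcd)).rep 1 * (a * b) +
            (Φ s(Projectivization.mk ℂ ![a, b] hab,
              Projectivization.mk ℂ ![c, d] hcd)).rep 2 * b ^ 2 = 0 ∧
          (Φ s(Projectivization.mk ℂ ![a, b] hab,
              Projectivization.mk ℂ ![c, d] hcd)).rep 0 * c ^ 2 +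
            (Φ s(Projectivization.mk ℂ ![a, b] hab,
              Projectivization.mk ℂ ![c, d] hcd)).rep 1 * (c * d) +
            (Φ s(Projectivization.mk ℂ ![a, b] hab,
              Projectivization.mk ℂ ![c, d] hcd)).rep 2 * d ^ 2 = 0) ∧
      -- (ii) Φ({p,q}) lies on the dual conic β² = 4αγ iff p = q
      (∀ p q : ProjLine,
          ((Φ s(p, q)).rep 1) ^ 2 = 4 * (Φ s(p, q)).rep 0 * (Φ s(p, q)).rep 2 ↔
            p = q) := by
  refine ⟨symMap, ?_, ⟨symMap_injective, symMap_surjective⟩, ?_, ?_⟩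
  · intro a b c d hab hcd h
    exact symMap_mk hab hcd
  · intro a b c d hab hcd
    obtain ⟨k, -, hk⟩ := symMap_rep hab hcd
    rw [hk]
    simp only [bil, Pi.smul_apply, smul_eq_mul, Matrix.cons_val]
    constructor <;> ring
  · intro p q
    induction p using Projectivization.ind with | _ v hv
    induction q using Projectivization.ind with | _ w hw
    constructor
    · obtain ⟨k, hk0, hk⟩ := symMap_rep hv hw
      rw [hk]
      simp only [bil, Pi.smul_apply, smul_eq_mul, Matrix.cons_val]
      intro h
      apply mk_eq_of_det
      have h2 : (k * (v 0 * w 1 - v 1 * w 0)) ^ 2 = 0 := by linear_combination h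
      simpa [hk0] using h2
    · intro h
      rw [← h]
      obtain ⟨k, hk0, hk⟩ := symMap_rep hv hv
      rw [hk]
      simp only [bil, Pi.smul_apply, smul_eq_mul, Matrix.cons_val]
      ring

end
end

section
/- There exists a nonzero polynomial function P on the 35-dimensional space of cubic forms in five variables over ℂ such that, for every cubic form F with P(F) ≠ 0, F defines a smooth cubic threefold V = V(F) ⊂ ℙ⁴ containing no line r for which there is a 2-plane π with V·π = 3r. (Equivalently: for a general smooth cubic threefold, no 2-plane meets V in a tripled line; this is the condition ensuring that the curve Γ′ of lines of the second type is smooth.) -/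
open MvPolynomial

noncomputable section

/-- `F` defines a smooth cubic threefold: the only common zero of the five partial
derivatives of `F` is the origin. -/
def IsSmoothCubic (F : MvPolynomial (Fin 5) ℂ) : Prop :=
  ∀ p : Fin 5 → ℂ, (∀ i : Fin 5, eval p (pderiv i F) = 0) → p = 0

/-- A line of `ℙ⁴`: a 2-dimensional linear subspace of `ℂ⁵`. -/
def IsLine (W : Submodule ℂ (Fin 5 → ℂ)) : Prop := Module.finrank ℂ W = 2

/-- A 2-plane of `ℙ⁴`: a 3-dimensional linear subspace of `ℂ⁵`. -/
def IsPlane (W : Submodule ℂ (Fin 5 → ℂ)) : Prop := Module.finrank ℂ W = 3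

/-- The linear subspace `W` lies on the hypersurface defined by `F`. -/
def LiesOn (F : MvPolynomial (Fin 5) ℂ) (W : Submodule ℂ (Fin 5 → ℂ)) : Prop :=
  ∀ p ∈ W, eval p F = 0

/-- The intersection cycle `V(F)·Pl` equals `l + 2r`: the restriction of `F` to the
2-plane `Pl` factors as `c·ℓ·ρ²` where `ℓ`, `ρ` are linear forms, nonzero on `Pl`,
whose kernels cut `l` and `r` respectively out of `Pl`. -/
def CycleLplus2R (F : MvPolynomial (Fin 5) ℂ) (l r Pl : Submodule ℂ (Fin 5 → ℂ)) : Prop :=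
  IsLine l ∧ IsLine r ∧ IsPlane Pl ∧ l ≤ Pl ∧ r ≤ Pl ∧ r ≠ l ∧
  ∃ (c : ℂ) (L R : (Fin 5 → ℂ) →ₗ[ℂ] ℂ), c ≠ 0 ∧
    (∃ p ∈ Pl, L p ≠ 0) ∧ (∃ p ∈ Pl, R p ≠ 0) ∧
    Pl ⊓ LinearMap.ker L = l ∧ Pl ⊓ LinearMap.ker R = r ∧
    ∀ p ∈ Pl, eval p F = c * L p * (R p) ^ 2


/-- The intersection cycle `V(F)·Pl` equals `3r`: the restriction of `F` to the
2-plane `Pl` factors as `c·ρ³` where `ρ` is a linear form, nonzero on `Pl`, whose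
kernel cuts `r` out of `Pl`. -/
def Cycle3R (F : MvPolynomial (Fin 5) ℂ) (r Pl : Submodule ℂ (Fin 5 → ℂ)) : Prop :=
  IsLine r ∧ IsPlane Pl ∧ r ≤ Pl ∧
  ∃ (c : ℂ) (R : (Fin 5 → ℂ) →ₗ[ℂ] ℂ), c ≠ 0 ∧
    (∃ p ∈ Pl, R p ≠ 0) ∧ Pl ⊓ LinearMap.ker R = r ∧
    ∀ p ∈ Pl, eval p F = c * (R p) ^ 3

/-- The index type of the 35 monomials of degree 3 in five variables, so that
`MvPolynomial Deg3Monomials ℂ` is the ring of polynomial functions (in the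
coefficients) on the 35-dimensional space of cubic forms in five variables. -/
def Deg3Monomials : Type := {d : Fin 5 →₀ ℕ // (d.sum fun _ n => n) = 3}


lemma exists_relation {σ : Type} [Fintype σ] {D : Type} [Fintype D]
    (h : Fintype.card σ < Fintype.card D) (f : D → MvPolynomial σ ℂ) :
    ∃ P : MvPolynomial D ℂ, P ≠ 0 ∧ aeval f P = 0 := by
  by_contra hcon
  push Not at hcon
  have hind : AlgebraicIndependent ℂ f := by
    rw [algebraicIndependent_iff]
    intro p hp
    by_contra hne
    exact hcon p hne hp
  have := hind.cardinalMk_le_trdeg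
  rw [MvPolynomial.trdeg_of_isDomain] at this
  simp at this
  omega

/-- The indexing of `D` by the complement of the range of `emb` together with the source. -/
def splitEquiv {D β : Type} (emb : β → D) (hemb : Function.Injective emb) :
    {d // d ∉ Set.range emb} ⊕ β ≃ D :=
  Equiv.ofBijective (Sum.elim Subtype.val emb) <| by
    constructor
    · rintro (⟨a, ha⟩ | b) (⟨a', ha'⟩ | b') h
      · simpa using h
      · exact absurd ⟨b', h.symm⟩ ha
      · exact absurd ⟨b, h⟩ ha'
      · exact congrArg _ (hemb h)
    · intro d
      by_cases hd : d ∈ Set.range emb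
      · obtain ⟨b, rfl⟩ := hd
        exact ⟨Sum.inr b, rfl⟩
      · exact ⟨Sum.inl ⟨d, hd⟩, rfl⟩

lemma sum_split {D β : Type} [Fintype D] [Fintype β] (emb : β → D)
    (hemb : Function.Injective emb) [Fintype {d // d ∉ Set.range emb}] (L : D → ℂ) :
    ∑ d, L d = ∑ a : {d // d ∉ Set.range emb}, L a.1 + ∑ b, L (emb b) := by
  rw [← (splitEquiv emb hemb).sum_comp, Fintype.sum_sum_type]
  rfl

lemma exists_chart_poly {D β τ : Type} [Fintype D] [Fintype β] [Fintype τ] (emb : β → D)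
    (hemb : Function.Injective emb) (hcard : Fintype.card τ < Fintype.card β)
    (g : β → MvPolynomial ({d // d ∉ Set.range emb} ⊕ τ) ℂ) :
    ∃ P : MvPolynomial D ℂ, P ≠ 0 ∧ ∀ (F : D → ℂ) (t : τ → ℂ),
      (∀ b, F (emb b) = eval (Sum.elim (fun a => F a.1) t) (g b)) → eval F P = 0 := by
  classical
  let E := splitEquiv emb hemb
  have hc : Fintype.card ({d // d ∉ Set.range emb} ⊕ τ) < Fintype.card D := by
    rw [← Fintype.card_congr E]
    simp only [Fintype.card_sum]
    omega
  obtain ⟨P, hP, hrel⟩ := exists_relation hc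
    (fun d => Sum.elim (fun a => X (Sum.inl a)) g (E.symm d))
  refine ⟨P, hP, fun F t hF => ?_⟩
  have h1 := congrArg (eval (Sum.elim (fun a => F a.1) t)) hrel
  rw [map_zero] at h1
  rw [← h1, ← MvPolynomial.coe_aeval_eq_eval, ← MvPolynomial.coe_aeval_eq_eval]
  simp only [RingHom.coe_coe]
  rw [← AlgHom.comp_apply, MvPolynomial.comp_aeval]
  congr 2
  funext d
  obtain ⟨x, rfl⟩ := E.surjective d
  rcases x with a | b
  · have : E (Sum.inl a) = a.1 := rfl
    rw [E.symm_apply_apply, this]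
    simp
  · have : E (Sum.inr b) = emb b := rfl
    rw [E.symm_apply_apply, this]
    simpa using hF b

/-- The underlying exponent vector. -/
def mon (d : Deg3Monomials) : Fin 5 →₀ ℕ := Subtype.val d

lemma mon_inj {d e : Deg3Monomials} (h : mon d = mon e) : d = e := Subtype.ext h

instance : Fintype Deg3Monomials :=
  Fintype.ofEquiv (Sym (Fin 5) 3) (Sym.equivNatSum (Fin 5) 3)

lemma cubic_as_sum (F : MvPolynomial (Fin 5) ℂ) (hF : F.IsHomogeneous 3) :
    F = ∑ d : Deg3Monomials, monomial (mon d) (F.coeff (mon d)) := by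
  classical
  ext m
  rw [coeff_sum]
  simp only [coeff_monomial]
  by_cases hm : (m.sum fun _ n => n) = 3
  · obtain ⟨d, rfl⟩ : ∃ d : Deg3Monomials, mon d = m := ⟨⟨m, hm⟩, rfl⟩
    rw [Fintype.sum_eq_single d]
    · simp
    · intro b hb
      rw [if_neg]
      intro h
      exact hb (mon_inj h)
  · rw [Finset.sum_eq_zero]
    · by_contra hne
      apply hm
      have := hF hne
      rw [← this]
      simp [Finsupp.weight_apply]
    · intro d _
      rw [if_neg]
      rintro rfl
      exact hm d.2

/-- The monomial `x_i² x_j`. -/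
def embSing (i j : Fin 5) : Deg3Monomials :=
  ⟨Finsupp.single i 2 + Finsupp.single j 1, by
    rw [Finsupp.sum_add_index'] <;> simp⟩

lemma embSing_inj (i : Fin 5) : Function.Injective (embSing i) := by
  intro j k h
  have h1 := congrArg mon h
  simpa [mon, embSing, Finsupp.single_left_inj] using h1

lemma eval_pderiv_emb (i j b : Fin 5) (p : Fin 5 → ℂ) (hp : p i = 1) :
    eval p (pderiv j (monomial (mon (embSing i b)) (1 : ℂ))) =
      if j = i then (if b = i then 3 else 2 * p b) else if b = j then 1 else 0 := by
  have : (monomial (mon (embSing i b)) (1 : ℂ)) = X i ^ 2 * X b := by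
    rw [mon, embSing, X_pow_eq_monomial, X, monomial_mul, one_mul]
  rw [this]
  by_cases hj : j = i
  · subst hj
    by_cases hb : b = j
    · subst hb
      simp [Derivation.leibniz, Derivation.leibniz_pow, hp]
      norm_num
    · simp [Derivation.leibniz, Derivation.leibniz_pow, hp, hb]
      ring
  · by_cases hb : b = j
    · subst hb
      simp [Derivation.leibniz, Derivation.leibniz_pow, hp, hj, Ne.symm hj]
    · simp [Derivation.leibniz, Derivation.leibniz_pow, hp, hj, hb, Ne.symm hj]

open Classical in
/-- The generic point with `i`-th coordinate one. -/
def genPt (i : Fin 5) (α : Type) (k : Fin 5) : MvPolynomial (α ⊕ {j : Fin 5 // j ≠ i}) ℂ :=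
  if h : k ≠ i then X (Sum.inr ⟨k, h⟩) else 1

/-- Contribution of the free coefficients to the `j`-th partial derivative, with sign. -/
def genQ (i j : Fin 5) : MvPolynomial
    ({d // d ∉ Set.range (embSing i)} ⊕ {j : Fin 5 // j ≠ i}) ℂ := by
  classical
  exact - ∑ a : {d // d ∉ Set.range (embSing i)},
    X (Sum.inl a) * (C (((mon a.1) j : ℕ) : ℂ) * ∏ k, genPt i _ k ^ ((mon a.1 - Finsupp.single j 1 : Fin 5 →₀ ℕ) k))

lemma singular_chart (i : Fin 5) :
    ∃ P : MvPolynomial Deg3Monomials ℂ, P ≠ 0 ∧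
      ∀ F : MvPolynomial (Fin 5) ℂ, F.IsHomogeneous 3 → ∀ p : Fin 5 → ℂ, p i = 1 →
        (∀ j, eval p (pderiv j F) = 0) →
        eval (fun d : Deg3Monomials => F.coeff (mon d)) P = 0 := by
  classical
  obtain ⟨P, hP, h⟩ := exists_chart_poly (τ := {j : Fin 5 // j ≠ i}) (embSing i) (embSing_inj i)
    (by simp)
    (fun b => if b = i then C (1/3) * (genQ i i - 2 * ∑ k ∈ Finset.univ.erase i,
      genQ i k * genPt i _ k) else genQ i b)
  refine ⟨P, hP, fun F hF p hp hd => ?_⟩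
  apply h _ (fun j => p j.1)
  set s : {d // d ∉ Set.range (embSing i)} ⊕ {j : Fin 5 // j ≠ i} → ℂ :=
    Sum.elim (fun a => F.coeff (mon a.1)) (fun j => p j.1) with hs
  have hpt : ∀ k, eval s (genPt i _ k) = p k := by
    intro k
    by_cases hk : k = i
    · subst hk
      simp [genPt, hp]
    · simp [genPt, hk, hs]
  have hmon : ∀ (j : Fin 5) (d : Fin 5 →₀ ℕ), eval p (pderiv j (monomial d (1:ℂ))) =
      (d j : ℂ) * ∏ k, p k ^ ((d - Finsupp.single j 1 : Fin 5 →₀ ℕ) k) := by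
    intro j d
    rw [pderiv_monomial, eval_monomial, Finsupp.prod_fintype _ _ (by simp)]
    simp
  have hQ : ∀ j, eval s (genQ i j) = - ∑ a : {d // d ∉ Set.range (embSing i)},
      F.coeff (mon a.1) * eval p (pderiv j (monomial (mon a.1) (1:ℂ))) := by
    intro j
    simp only [hmon]
    simp only [genQ, map_neg, map_sum, map_mul, map_prod, map_pow, hpt, eval_X, eval_C]
    simp [hs]
  have hsum : ∀ j, ∑ b, F.coeff (mon (embSing i b)) *
      eval p (pderiv j (monomial (mon (embSing i b)) (1:ℂ))) = eval s (genQ i j) := by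
    intro j
    have h1 := hd j
    rw [cubic_as_sum F hF] at h1
    have h2 : ∀ d : Deg3Monomials, monomial (mon d) (F.coeff (mon d)) =
        C (F.coeff (mon d)) * monomial (mon d) (1:ℂ) := by
      intro d
      rw [C_mul_monomial, mul_one]
    simp only [h2, map_sum, pderiv_C_mul, map_mul, eval_C] at h1
    rw [sum_split (embSing i) (embSing_inj i)] at h1
    rw [hQ]
    linear_combination h1
  have hne : ∀ j, j ≠ i → F.coeff (mon (embSing i j)) = eval s (genQ i j) := by
    intro j hj
    rw [← hsum j]
    simp only [eval_pderiv_emb _ _ _ _ hp, hj, if_false]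
    simp
  intro b
  by_cases hb : b = i
  · subst hb
    have h3 := hsum b
    rw [← Finset.add_sum_erase _ _ (Finset.mem_univ b)] at h3
    have h4 : ∑ k ∈ Finset.univ.erase b, F.coeff (mon (embSing b k)) *
        eval p (pderiv b (monomial (mon (embSing b k)) (1:ℂ))) =
        2 * ∑ k ∈ Finset.univ.erase b, eval s (genQ b k) * p k := by
      rw [Finset.mul_sum]
      apply Finset.sum_congr rfl
      intro k hk
      have hk' := Finset.ne_of_mem_erase hk
      rw [eval_pderiv_emb _ _ _ _ hp, hne k hk']
      simp [hk']
      ring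
    rw [h4, eval_pderiv_emb _ _ _ _ hp] at h3
    simp only [if_true, map_mul, map_sub, map_sum, hpt, eval_C, map_ofNat]
    simp only [if_true] at h3
    linear_combination (1/3) * h3
  · simp only [hb, if_false]
    exact hne b hb

lemma eval_smul_homog {G : MvPolynomial (Fin 5) ℂ} {n : ℕ} (hG : G.IsHomogeneous n) (c : ℂ)
    (p : Fin 5 → ℂ) : eval (c • p) G = c ^ n * eval p G := by
  rw [eval_eq', eval_eq', Finset.mul_sum]
  apply Finset.sum_congr rfl
  intro d hd
  have : ∑ i, d i = n := by
    rw [← hG (mem_support_iff.1 hd)]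
    simp [Finsupp.weight_apply, Finsupp.sum_fintype]
  simp only [Pi.smul_apply, smul_eq_mul, mul_pow, Finset.prod_mul_distrib, Finset.prod_pow_eq_pow_sum,
    this]
  ring

lemma singular_poly :
    ∃ P : MvPolynomial Deg3Monomials ℂ, P ≠ 0 ∧
      ∀ F : MvPolynomial (Fin 5) ℂ, F.IsHomogeneous 3 → 
        eval (fun d : Deg3Monomials => F.coeff (mon d)) P ≠ 0 → IsSmoothCubic F := by
  choose P hP h using singular_chart
  refine ⟨∏ i, P i, Finset.prod_ne_zero_iff.2 fun i _ => hP i, fun F hF hne p hp => ?_⟩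
  by_contra hp0
  obtain ⟨i, hi⟩ := Function.ne_iff.1 hp0
  rw [map_prod, Finset.prod_ne_zero_iff] at hne
  apply hne i (Finset.mem_univ i)
  apply h i F hF ((p i)⁻¹ • p)
  · simpa using inv_mul_cancel₀ hi
  · intro j
    rw [eval_smul_homog (hF.pderiv (i := j)), hp j, mul_zero]

/-- Degree three monomials in three variables. -/
abbrev Mon3 : Type := {m : Fin 3 →₀ ℕ // m.sum (fun _ => id) = 3}

instance : Fintype Mon3 := Fintype.ofEquiv (Sym (Fin 3) 3) (Sym.equivNatSum (Fin 3) 3)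

lemma card_mon3 : Fintype.card Mon3 = 10 := by
  rw [← Fintype.card_congr (Sym.equivNatSum (Fin 3) 3), Sym.card_sym_eq_multichoose, Fintype.card_fin,
    Nat.multichoose_eq]
  decide

/-- A monomial in three variables as a monomial in five variables. -/
def embPl (e : Fin 3 → Fin 5) (m : Mon3) : Deg3Monomials :=
  ⟨m.1.mapDomain e, by
    rw [Finsupp.sum_mapDomain_index (by simp) (by simp)]
    exact m.2⟩

lemma embPl_inj (e : Fin 3 → Fin 5) (he : Function.Injective e) :
    Function.Injective (embPl e) := by
  intro m n h
  have h1 : mon (embPl e m) = mon (embPl e n) := congrArg mon h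
  exact Subtype.ext (Finsupp.mapDomain_injective he h1)

/-- Parameters: a scalar, the coefficients of a linear form, and those of a plane. -/
abbrev PlPar (e : Fin 3 → Fin 5) (k : Fin 3) : Type :=
  (Unit ⊕ {a : Fin 3 // a ≠ k}) ⊕ ({j : Fin 5 // j ∉ Set.range e} × Fin 3)

lemma card_plPar (e : Fin 3 → Fin 5) (he : Function.Injective e) (k : Fin 3)
    [Fintype (PlPar e k)] : Fintype.card (PlPar e k) = 9 := by
  classical
  have h1 := Fintype.card_congr (splitEquiv e he)
  rw [Fintype.card_sum] at h1
  simp only [Fintype.card_fin] at h1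
  have h2 : Fintype.card {j : Fin 5 // j ∉ Set.range e} = 2 := by omega
  have h3 : Fintype.card {a : Fin 3 // a ≠ k} = 2 := by simp
  have h4 : Fintype.card (PlPar e k) = (1 + Fintype.card {a : Fin 3 // a ≠ k}) +
      Fintype.card {j : Fin 5 // j ∉ Set.range e} * 3 := by
    rw [← Nat.card_eq_fintype_card, Nat.card_sum, Nat.card_sum, Nat.card_prod]
    simp [Nat.card_eq_fintype_card]
  rw [h4, h2, h3]

open Classical in
/-- The generic parametrisation of a plane. -/
def genPhi (e : Fin 3 → Fin 5) (k : Fin 3) (α : Type) (j : Fin 5) :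
    MvPolynomial (Fin 3) (MvPolynomial (α ⊕ PlPar e k) ℂ) :=
  if h : j ∈ Set.range e then X h.choose else
    ∑ a, C (X (Sum.inr (Sum.inr (⟨j, h⟩, a)))) * X a

open Classical in
/-- The generic linear form with `k`-th coefficient one. -/
def genL (e : Fin 3 → Fin 5) (k : Fin 3) (α : Type) :
    MvPolynomial (Fin 3) (MvPolynomial (α ⊕ PlPar e k) ℂ) :=
  ∑ a, (if h : a ≠ k then C (X (Sum.inr (Sum.inl (Sum.inr ⟨a, h⟩)))) else 1) * X a

lemma plane_chart (e : Fin 3 → Fin 5) (he : Function.Injective e) (k : Fin 3) :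
    ∃ P : MvPolynomial Deg3Monomials ℂ, P ≠ 0 ∧
      ∀ F : MvPolynomial (Fin 5) ℂ, F.IsHomogeneous 3 → ∀ w : Fin 3 → Fin 5 → ℂ,
        (∀ a b, w a (e b) = if a = b then 1 else 0) → ∀ (c : ℂ) (u : Fin 3 → ℂ), u k = 1 →
        (∀ y : Fin 3 → ℂ, eval (∑ a, y a • w a) F = c * (∑ a, y a * u a) ^ 3) →
        eval (fun d : Deg3Monomials => F.coeff (mon d)) P = 0 := by
  classical
  obtain ⟨P, hP, h⟩ := exists_chart_poly (τ := PlPar e k) (embPl e) (embPl_inj e he)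
    (by rw [card_plPar e he, card_mon3]; norm_num)
    (fun b => X (Sum.inr (Sum.inl (Sum.inl ()))) * coeff b.1 (genL e k _ ^ 3) -
      ∑ a : {d // d ∉ Set.range (embPl e)},
        X (Sum.inl a) * coeff b.1 (∏ j, genPhi e k _ j ^ (mon a.1 j)))
  refine ⟨P, hP, fun F hF w hw c u hu hy => ?_⟩
  apply h _ (Sum.elim (Sum.elim (fun _ => c) (fun a => u a.1)) (fun x => w x.2 x.1.1))
  intro b
  set s : {d // d ∉ Set.range (embPl e)} ⊕ PlPar e k → ℂ :=
    Sum.elim (fun a => F.coeff (mon a.1))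
      (Sum.elim (Sum.elim (fun _ => c) (fun a => u a.1)) (fun x => w x.2 x.1.1)) with hs
  let φ : Fin 5 → MvPolynomial (Fin 3) ℂ := fun j => ∑ a, C (w a j) * X a
  let L : MvPolynomial (Fin 3) ℂ := ∑ a, C (u a) * X a
  have hφe : ∀ a, φ (e a) = X a := by
    intro a
    simp [φ, hw]
  have hφ : ∀ j, map (eval s) (genPhi e k _ j) = φ j := by
    intro j
    by_cases hj : j ∈ Set.range e
    · rw [genPhi, dif_pos hj, map_X, ← hφe, hj.choose_spec]
    · rw [genPhi, dif_neg hj]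
      simp [φ, hs]
  have hL : map (eval s) (genL e k _) = L := by
    simp only [genL, L, map_sum, map_mul, map_X]
    apply Finset.sum_congr rfl
    intro a _
    by_cases ha : a = k
    · subst ha
      simp [hu]
    · simp [ha, hs]
  have hFL : aeval φ F = C c * L ^ 3 := by
    apply MvPolynomial.funext
    intro y
    have h1 : eval y (aeval φ F) = eval (∑ a, y a • w a) F := by
      rw [← MvPolynomial.coe_aeval_eq_eval, ← MvPolynomial.coe_aeval_eq_eval]
      simp only [RingHom.coe_coe]
      rw [← AlgHom.comp_apply, MvPolynomial.comp_aeval]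
      congr 2
      funext j
      simp [φ, mul_comm]
    rw [h1, hy]
    simp [L, mul_comm]
  have hco := congrArg (coeff b.1) hFL
  rw [coeff_C_mul] at hco
  conv_lhs at hco => rw [cubic_as_sum F hF]
  have hmon : ∀ d : Deg3Monomials, coeff b.1 (aeval φ (monomial (mon d) (F.coeff (mon d)))) =
      F.coeff (mon d) * coeff b.1 (∏ j, φ j ^ (mon d j)) := by
    intro d
    rw [aeval_monomial, Finsupp.prod_fintype _ _ (by simp), algebraMap_eq, coeff_C_mul]
  have hemb : ∀ m : Mon3, ∏ j, φ j ^ (mon (embPl e m) j) = monomial m.1 1 := by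
    intro m
    rw [← Finsupp.prod_fintype (mon (embPl e m)) (fun j n => φ j ^ n) (by simp)]
    rw [mon, embPl, Finsupp.prod_mapDomain_index (by simp) (by simp [pow_add])]
    simp only [hφe]
    rw [monomial_eq]
    simp
  rw [map_sum, coeff_sum] at hco
  simp only [hmon] at hco
  rw [sum_split (embPl e) (embPl_inj e he)] at hco
  simp only [hemb, coeff_monomial] at hco
  have h5 : ∑ m : Mon3, F.coeff (mon (embPl e m)) * (if m.1 = b.1 then (1:ℂ) else 0) =
      F.coeff (mon (embPl e b)) := by
    rw [Fintype.sum_eq_single b]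
    · simp
    · intro m hm
      rw [if_neg (fun hh => hm (Subtype.ext hh)), mul_zero]
  rw [h5] at hco
  simp only [map_sub, map_mul, map_sum, eval_X, ← coeff_map, map_pow, map_prod, hφ, hL]
  simp only [hs, Sum.elim_inl, Sum.elim_inr]
  linear_combination hco

lemma exists_frame (W : Submodule ℂ (Fin 5 → ℂ)) (hW : IsPlane W) :
    ∃ (e : Fin 3 → Fin 5) (w : Fin 3 → Fin 5 → ℂ), Function.Injective e ∧ (∀ a, w a ∈ W) ∧
      ∀ a b, w a (e b) = if a = b then 1 else 0 := by
  classical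
  let v : Fin 5 → Module.Dual ℂ W := fun j => (LinearMap.proj j).comp W.subtype
  have hspan : Submodule.span ℂ (Set.range v) = ⊤ := by
    rw [← Subspace.dualCoannihilator_dualAnnihilator_eq (W := Submodule.span ℂ (Set.range v))]
    have : (Submodule.span ℂ (Set.range v)).dualCoannihilator = ⊥ := by
      rw [eq_bot_iff]
      intro x hx
      rw [Submodule.mem_dualCoannihilator] at hx
      rw [Submodule.mem_bot]
      ext j
      exact hx (v j) (Submodule.subset_span ⟨j, rfl⟩)
    rw [this]
    simp
  obtain ⟨κ, a, ha, hsp, hli⟩ := exists_linearIndependent' ℂ v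
  have : Finite κ := Finite.of_injective a ha
  have : Fintype κ := Fintype.ofFinite κ
  let B := Module.Basis.mk hli (by rw [hsp, hspan])
  have hcard : Fintype.card κ = 3 := by
    rw [← Module.finrank_eq_card_basis B, Subspace.dual_finrank_eq]
    exact hW
  let ε : Fin 3 ≃ κ := (Fintype.equivFinOfCardEq hcard).symm
  refine ⟨fun x => a (ε x), fun x => ((Module.evalEquiv ℂ W).symm (B.dualBasis (ε x)) : W).1,
    ha.comp ε.injective, fun x => Subtype.property _, fun x y => ?_⟩
  have h1 : B (ε y) = v (a (ε y)) := by simp [B]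
  have h2 : v (a (ε y)) ((Module.evalEquiv ℂ W).symm (B.dualBasis (ε x))) =
      B.dualBasis (ε x) (B (ε y)) := by
    rw [h1, Module.apply_evalEquiv_symm_apply]
  rw [Module.Basis.dualBasis_apply_self] at h2
  refine h2.trans ?_
  simp [eq_comm]

lemma exists_prod_poly {ι D : Type} [Finite ι] (P : ι → MvPolynomial D ℂ) (hP : ∀ i, P i ≠ 0) :
    ∃ Q : MvPolynomial D ℂ, Q ≠ 0 ∧ ∀ v, eval v Q ≠ 0 → ∀ i, eval v (P i) ≠ 0 := by
  have := Fintype.ofFinite ι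
  refine ⟨∏ i, P i, Finset.prod_ne_zero_iff.2 fun i _ => hP i, fun v hv i => ?_⟩
  rw [map_prod, Finset.prod_ne_zero_iff] at hv
  exact hv i (Finset.mem_univ i)

/-- For a general smooth cubic threefold `V ⊂ ℙ⁴`, no 2-plane meets `V` in a tripled
line: there is no line `r` on `V` with a 2-plane `π` such that `V·π = 3r`. -/
theorem general_cubic_has_no_tripled_line :
    ∃ P : MvPolynomial Deg3Monomials ℂ, P ≠ 0 ∧
      ∀ F : MvPolynomial (Fin 5) ℂ, F.IsHomogeneous 3 →
        eval (fun d : Deg3Monomials => F.coeff d.1) P ≠ 0 →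
        IsSmoothCubic F ∧
        ¬∃ r Pl : Submodule ℂ (Fin 5 → ℂ), LiesOn F r ∧ Cycle3R F r Pl := by
  classical
  obtain ⟨P₁, hP₁, h₁⟩ := singular_poly
  have hc : ∀ x : {e : Fin 3 → Fin 5 // Function.Injective e} × Fin 3, _ :=
    fun x => plane_chart x.1.1 x.1.2 x.2
  choose P hP h using hc
  obtain ⟨Q, hQ, hQP⟩ := exists_prod_poly P hP
  refine ⟨P₁ * Q, mul_ne_zero hP₁ hQ,
    fun F hF hne => ?_⟩
  change eval (fun d : Deg3Monomials => F.coeff (mon d)) _ ≠ 0 at hne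
  rw [map_mul, mul_ne_zero_iff] at hne
  refine ⟨h₁ F hF hne.1, ?_⟩
  have hx := hQP _ hne.2
  rintro ⟨r, Pl, -, -, hPl, -, c, R, -, -, -, hR⟩
  obtain ⟨e, w, he, hwm, hw⟩ := exists_frame Pl hPl
  have hy : ∀ y : Fin 3 → ℂ, eval (∑ a, y a • w a) F = c * (∑ a, y a * R (w a)) ^ 3 := by
    intro y
    rw [hR _ (Submodule.sum_mem _ fun a _ => Submodule.smul_mem _ _ (hwm a))]
    simp
  by_cases hz : ∃ k, R (w k) ≠ 0
  · obtain ⟨k, hk⟩ := hz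
    refine hx (⟨e, he⟩, k) (h (⟨e, he⟩, k) F hF w hw (c * R (w k) ^ 3)
      (fun a => R (w a) / R (w k)) (div_self hk) fun y => ?_)
    rw [hy, mul_assoc, ← mul_pow, Finset.mul_sum]
    congr 3
    funext a
    field_simp
  · push Not at hz
    refine hx (⟨e, he⟩, 0) (h (⟨e, he⟩, 0) F hF w hw 0
      (fun _ => 1) rfl fun y => ?_)
    rw [hy]
    simp [hz]

end
end

section
/- There exists a nonzero polynomial function P on the 35-dimensional space of cubic forms in five variables over ℂ such that, for every cubic form F with P(F) ≠ 0, F defines a smooth cubic threefold V = V(F) ⊂ ℙ⁴ containing no line l for which there exist three pairwise distinct lines r₁, r₂, r₃ on V and 2-planes π₁, π₂, π₃ with V·πᵢ = l + 2rᵢ for i = 1, 2, 3. (Equivalently: for a general smooth cubic threefold, no line l ∈ Γ admits three or more preimages in Γ′, so the singular points of Γ have multiplicity 2.) -/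
open MvPolynomial

noncomputable section

/-! ### Elimination -/

lemma card_deg3 : Cardinal.mk Deg3Monomials = 35 := by
  have e : Sym (Fin 5) 3 ≃ Deg3Monomials := Sym.equivNatSum (Fin 5) 3
  rw [← Cardinal.mk_congr e, Cardinal.mk_fintype, Sym.card_sym_eq_choose]
  simp [Nat.choose]

/-- A family of cubics depending polynomially on fewer than 35 parameters lies in a hypersurface. -/
lemma exists_elim {κ : Type} [Fintype κ] (h : Fintype.card κ < 35)
    (G : MvPolynomial (Fin 5) (MvPolynomial κ ℂ)) :
    ∃ P : MvPolynomial Deg3Monomials ℂ, P ≠ 0 ∧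
      aeval (fun d : Deg3Monomials => coeff d.1 G) P = 0 := by
  have h1 : ¬ AlgebraicIndependent ℂ (fun d : Deg3Monomials => coeff d.1 G) := by
    intro hi
    have := hi.cardinalMk_le_trdeg
    rw [MvPolynomial.trdeg_of_isDomain, card_deg3, Cardinal.mk_fintype] at this
    simp only [Cardinal.lift_natCast] at this
    have h2 : (35 : ℕ) ≤ Fintype.card κ := by exact_mod_cast this
    omega
  rw [algebraicIndependent_iff] at h1
  push Not at h1
  obtain ⟨P, h2, h3⟩ := h1
  exact ⟨P, h3, h2⟩

lemma eval_aeval_coeff {κ : Type} (G : MvPolynomial (Fin 5) (MvPolynomial κ ℂ))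
    (P : MvPolynomial Deg3Monomials ℂ) (t : κ → ℂ) :
    eval t (aeval (fun d : Deg3Monomials => coeff d.1 G) P) =
      eval (fun d : Deg3Monomials => coeff d.1 (map (eval t) G)) P := by
  induction P using MvPolynomial.induction_on with
  | C a => simp
  | add p q hp hq => rw [map_add, map_add, map_add, hp, hq]
  | mul_X p i hp => rw [map_mul, map_mul, map_mul, hp, aeval_X, eval_X, coeff_map]

lemma exists_elim' {κ : Type} [Fintype κ] (h : Fintype.card κ < 35)
    (G : MvPolynomial (Fin 5) (MvPolynomial κ ℂ)) :
    ∃ P : MvPolynomial Deg3Monomials ℂ, P ≠ 0 ∧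
      ∀ (F : MvPolynomial (Fin 5) ℂ) (t : κ → ℂ), (∀ x, eval x F = eval x (map (eval t) G)) →
        eval (fun d : Deg3Monomials => coeff d.1 F) P = 0 := by
  obtain ⟨P, h1, h2⟩ := exists_elim h G
  refine ⟨P, h1, fun F t hF => ?_⟩
  rw [MvPolynomial.funext hF, ← eval_aeval_coeff, h2, map_zero]

/-! ### Polarization -/

/-- A symmetric trilinear form, as a function. -/
structure SymTri where
  T : (Fin 5 → ℂ) → (Fin 5 → ℂ) → (Fin 5 → ℂ) → ℂ
  add1 : ∀ u u' v w, T (u + u') v w = T u v w + T u' v w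
  smul1 : ∀ (a : ℂ) u v w, T (a • u) v w = a * T u v w
  s12 : ∀ u v w, T u v w = T v u w
  s23 : ∀ u v w, T u v w = T u w v

namespace SymTri
variable (S : SymTri)

lemma add2 (u v v' w) : S.T u (v + v') w = S.T u v w + S.T u v' w := by
  rw [S.s12, S.add1, S.s12 v, S.s12 v']
lemma smul2 (a : ℂ) (u v w) : S.T u (a • v) w = a * S.T u v w := by
  rw [S.s12, S.smul1, S.s12 v]
lemma add3 (u v w w') : S.T u v (w + w') = S.T u v w + S.T u v w' := by
  rw [S.s23, S.add2, S.s23 u w, S.s23 u w']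
lemma smul3 (a : ℂ) (u v w) : S.T u v (a • w) = a * S.T u v w := by
  rw [S.s23, S.smul2, S.s23 u w]
lemma s13 (u v w) : S.T u v w = S.T w v u := by
  rw [S.s12, S.s23, S.s12]

lemma cube_add (x y) : S.T (x + y) (x + y) (x + y) =
    S.T x x x + 3 * S.T x x y + 3 * S.T x y y + S.T y y y := by
  simp only [S.add1, S.add2, S.add3]
  rw [S.s23 x y x, S.s13 y x x, S.s12 y x y, S.s13 y y x]
  ring

lemma sum1 {ι : Type} (s : Finset ι) (f : ι → Fin 5 → ℂ) (v w) :
    S.T (∑ i ∈ s, f i) v w = ∑ i ∈ s, S.T (f i) v w := by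
  classical
  induction s using Finset.induction_on with
  | empty => simpa using S.smul1 0 0 v w
  | insert a s ha ih => rw [Finset.sum_insert ha, Finset.sum_insert ha, S.add1, ih]

lemma expand1 (u v w) : S.T u v w = ∑ i, u i * S.T (Pi.single i 1) v w := by
  conv_lhs => rw [pi_eq_sum_univ' u, S.sum1]
  refine Finset.sum_congr rfl fun i _ => ?_
  rw [S.smul1]

lemma expand2 (u v w) : S.T u v w = ∑ i, v i * S.T u (Pi.single i 1) w := by
  rw [S.s12, S.expand1]
  exact Finset.sum_congr rfl fun i _ => by rw [S.s12]

lemma expand3 (u v w) : S.T u v w = ∑ i, w i * S.T u v (Pi.single i 1) := by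
  rw [S.s23, S.expand2]
  exact Finset.sum_congr rfl fun i _ => by rw [S.s23]

lemma expand (u v w) : S.T u v w = ∑ i, ∑ j, ∑ k,
    S.T (Pi.single i 1) (Pi.single j 1) (Pi.single k 1) * (u i * v j * w k) := by
  rw [S.expand1]
  refine Finset.sum_congr rfl fun i _ => ?_
  rw [S.expand2, Finset.mul_sum]
  refine Finset.sum_congr rfl fun j _ => ?_
  rw [S.expand3, Finset.mul_sum, Finset.mul_sum]
  refine Finset.sum_congr rfl fun k _ => ?_
  ring

end SymTri

lemma pderiv_comm' (i j : Fin 5) (F : MvPolynomial (Fin 5) ℂ) :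
    pderiv i (pderiv j F) = pderiv j (pderiv i F) := by
  have h : ⁅(pderiv i : Derivation ℂ (MvPolynomial (Fin 5) ℂ) (MvPolynomial (Fin 5) ℂ)),
      (pderiv j : Derivation ℂ (MvPolynomial (Fin 5) ℂ) (MvPolynomial (Fin 5) ℂ))⁆ = 0 := by
    apply MvPolynomial.derivation_ext
    intro k
    simp only [Derivation.commutator_apply, pderiv_X, Derivation.coe_zero, Pi.zero_apply]
    simp only [Pi.single_apply]
    split_ifs <;> simp
  have := congrArg (fun D => D F) h
  simpa [Derivation.commutator_apply, sub_eq_zero] using this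

lemma hom_zero_eval (G : MvPolynomial (Fin 5) ℂ) (hG : G.IsHomogeneous 0) (x y) :
    eval x G = eval y G := by
  rw [← MvPolynomial.totalDegree_zero_iff_isHomogeneous] at hG
  rw [totalDegree_eq_zero_iff_eq_C.1 hG]; simp

lemma euler_eval (n : ℕ) (G : MvPolynomial (Fin 5) ℂ) (hG : G.IsHomogeneous n) (x) :
    ∑ i, x i * eval x (pderiv i G) = n * eval x G := by
  have := congrArg (eval x) hG.sum_X_mul_pderiv
  simpa using this

lemma exists_tri (F : MvPolynomial (Fin 5) ℂ) (hF : F.IsHomogeneous 3) :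
    ∃ S : SymTri, (∀ x, eval x F = S.T x x x) ∧
      ∀ i x, eval x (pderiv i F) = 3 * S.T (Pi.single i 1) x x := by
  have h1 : ∀ i, (pderiv i F).IsHomogeneous 2 := fun i => hF.pderiv
  have h2 : ∀ i j, (pderiv j (pderiv i F)).IsHomogeneous 1 := fun i j => (h1 i).pderiv
  have h3 : ∀ i j k, (pderiv k (pderiv j (pderiv i F))).IsHomogeneous 0 :=
    fun i j k => (h2 i j).pderiv
  let τ : Fin 5 → Fin 5 → Fin 5 → ℂ := fun i j k => eval 0 (pderiv k (pderiv j (pderiv i F)))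
  have t12 : ∀ i j k, τ i j k = τ j i k := fun i j k => by
    simp only [τ]; rw [pderiv_comm' j i]
  have t23 : ∀ i j k, τ i j k = τ i k j := fun i j k => by
    simp only [τ]; rw [pderiv_comm' k j]
  have e1 : ∀ i x, eval x (pderiv i F) = (1/2) * ∑ j, ∑ k, τ i j k * (x j * x k) := by
    intro i x
    have a := euler_eval 2 _ (h1 i) x
    have b : ∀ j, eval x (pderiv j (pderiv i F)) = ∑ k, x k * τ i j k := by
      intro j
      have c := euler_eval 1 _ (h2 i j) x
      rw [Nat.cast_one, one_mul] at c
      rw [← c]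
      exact Finset.sum_congr rfl fun k _ => by rw [hom_zero_eval _ (h3 i j k) x 0]
    simp only [b, Finset.mul_sum] at a
    push_cast at a
    have : eval x (pderiv i F) = (1/2) * (2 * eval x (pderiv i F)) := by ring
    rw [this, ← a]
    congr 1
    exact Finset.sum_congr rfl fun j _ => Finset.sum_congr rfl fun k _ => by ring
  refine ⟨⟨fun u v w => (1/6) * ∑ i, ∑ j, ∑ k, τ i j k * (u i * v j * w k),
    ?_, ?_, ?_, ?_⟩, ?_, ?_⟩
  · intro u u' v w
    simp only [← mul_add, ← Finset.sum_add_distrib, Pi.add_apply, add_mul]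
  · intro a u v w
    simp only [Finset.mul_sum, Pi.smul_apply, smul_eq_mul]
    exact Finset.sum_congr rfl fun i _ => Finset.sum_congr rfl fun j _ =>
      Finset.sum_congr rfl fun k _ => by ring
  · intro u v w
    refine congrArg (fun z => (1/6 : ℂ) * z) (Finset.sum_comm.trans ?_)
    exact Finset.sum_congr rfl fun i _ => Finset.sum_congr rfl fun j _ =>
      Finset.sum_congr rfl fun k _ => by rw [t12 j i k]; ring
  · intro u v w
    refine congrArg (fun z => (1/6 : ℂ) * z) (Finset.sum_congr rfl fun i _ => ?_)
    refine Finset.sum_comm.trans ?_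
    exact Finset.sum_congr rfl fun j _ =>
      Finset.sum_congr rfl fun k _ => by rw [t23 i k j]; ring
  · intro x
    have a := euler_eval 3 F hF x
    simp only [e1] at a
    have : eval x F = (1/3) * ((3 : ℕ) * eval x F) := by push_cast; ring
    rw [this, ← a]
    simp only [Finset.mul_sum]
    exact Finset.sum_congr rfl fun i _ => Finset.sum_congr rfl fun j _ =>
      Finset.sum_congr rfl fun k _ => by ring
  · intro i x
    rw [e1]
    have : ∀ f : Fin 5 → ℂ, ∑ a, f a * (Pi.single i (1 : ℂ) : Fin 5 → ℂ) a = f i := by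
      intro f; simp [Pi.single_apply]
    have h : ∀ a, (∑ j, ∑ k, τ a j k * ((Pi.single i (1 : ℂ) : Fin 5 → ℂ) a * x j * x k)) =
        (∑ j, ∑ k, τ a j k * (x j * x k)) * (Pi.single i (1 : ℂ) : Fin 5 → ℂ) a := by
      intro a
      simp only [Finset.sum_mul]
      exact Finset.sum_congr rfl fun j _ => Finset.sum_congr rfl fun k _ => by ring
    simp only [h, this]
    ring

/-! ### Collecting coefficients -/

lemma sum_collect {I ι : Type} [Fintype I] [Fintype ι] [DecidableEq ι] {n : ℕ}
    (f : I → Sym ι n) (τ : I → ℂ) : ∃ c : Sym ι n → ℂ, ∀ y : ι → ℂ,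
      ∑ a, τ a * ((f a).1.map y).prod = ∑ s, c s * (s.1.map y).prod := by
  refine ⟨fun s => ∑ a with f a = s, τ a, fun y => ?_⟩
  rw [← Finset.sum_fiberwise (s := Finset.univ) (g := f)]
  refine Finset.sum_congr rfl fun s _ => ?_
  rw [Finset.sum_mul]
  refine Finset.sum_congr rfl fun a ha => ?_
  rw [(Finset.mem_filter.1 ha).2]

lemma quad_collect {ι : Type} [Fintype ι] [DecidableEq ι] (τ : ι → ι → ℂ) :
    ∃ c : Sym ι 2 → ℂ, ∀ y : ι → ℂ,
      ∑ i, ∑ j, τ i j * (y i * y j) = ∑ s, c s * (s.1.map y).prod := by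
  obtain ⟨c, hc⟩ := sum_collect (fun a : ι × ι => a.1 ::ₛ a.2 ::ₛ Sym.nil) (fun a => τ a.1 a.2)
  refine ⟨c, fun y => ?_⟩
  rw [← hc, Fintype.sum_prod_type]
  refine Finset.sum_congr rfl fun i _ => Finset.sum_congr rfl fun j _ => ?_
  change _ = _ * ((i ::ₘ j ::ₘ (0 : Multiset ι)).map y).prod
  simp

lemma cubic_collect {ι : Type} [Fintype ι] [DecidableEq ι] (τ : ι → ι → ι → ℂ) :
    ∃ c : Sym ι 3 → ℂ, ∀ y : ι → ℂ,
      ∑ i, ∑ j, ∑ k, τ i j k * (y i * y j * y k) = ∑ s, c s * (s.1.map y).prod := by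
  obtain ⟨c, hc⟩ := sum_collect (fun a : ι × ι × ι => a.1 ::ₛ a.2.1 ::ₛ a.2.2 ::ₛ Sym.nil)
    (fun a => τ a.1 a.2.1 a.2.2)
  refine ⟨c, fun y => ?_⟩
  rw [← hc, Fintype.sum_prod_type]
  refine Finset.sum_congr rfl fun i _ => ?_
  rw [Fintype.sum_prod_type]
  refine Finset.sum_congr rfl fun j _ => Finset.sum_congr rfl fun k _ => ?_
  change _ = _ * ((i ::ₘ j ::ₘ k ::ₘ (0 : Multiset ι)).map y).prod
  simp [mul_assoc]

namespace SymTri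
variable (S : SymTri)

lemma comb1 {ι : Type} [Fintype ι] (b : ι → Fin 5 → ℂ) (y : ι → ℂ) (v w) :
    S.T (∑ i, y i • b i) v w = ∑ i, y i * S.T (b i) v w := by
  rw [S.sum1]; exact Finset.sum_congr rfl fun i _ => S.smul1 _ _ _ _

lemma comb2 {ι : Type} [Fintype ι] (b : ι → Fin 5 → ℂ) (y : ι → ℂ) (v w) :
    S.T v (∑ i, y i • b i) w = ∑ i, y i * S.T v (b i) w := by
  rw [S.s12, S.comb1]; exact Finset.sum_congr rfl fun i _ => by rw [S.s12]

lemma comb3 {ι : Type} [Fintype ι] (b : ι → Fin 5 → ℂ) (y : ι → ℂ) (v w) :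
    S.T v w (∑ i, y i • b i) = ∑ i, y i * S.T v w (b i) := by
  rw [S.s23, S.comb2]; exact Finset.sum_congr rfl fun i _ => by rw [S.s23]

lemma cubic_form {ι : Type} [Fintype ι] [DecidableEq ι] (b : ι → Fin 5 → ℂ) :
    ∃ c : Sym ι 3 → ℂ, ∀ y : ι → ℂ,
      S.T (∑ i, y i • b i) (∑ i, y i • b i) (∑ i, y i • b i) = ∑ s, c s * (s.1.map y).prod := by
  obtain ⟨c, hc⟩ := cubic_collect (fun i j k => S.T (b i) (b j) (b k))
  refine ⟨c, fun y => ?_⟩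
  rw [← hc, S.comb1]
  refine Finset.sum_congr rfl fun i _ => ?_
  rw [S.comb2, Finset.mul_sum]
  refine Finset.sum_congr rfl fun j _ => ?_
  rw [S.comb3, Finset.mul_sum, Finset.mul_sum]
  exact Finset.sum_congr rfl fun k _ => by ring

lemma quad_expand {ι : Type} [Fintype ι] (b : ι → Fin 5 → ℂ) (p) (y : ι → ℂ) :
      S.T (∑ i, y i • b i) (∑ i, y i • b i) p =
        ∑ i, ∑ j, S.T (b i) (b j) p * (y i * y j) := by
  rw [S.comb1]
  refine Finset.sum_congr rfl fun i _ => ?_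
  rw [S.comb2, Finset.mul_sum]
  exact Finset.sum_congr rfl fun j _ => by ring

end SymTri

/-! ### Singular cubics -/

lemma smooth_chart (j : Fin 5) : ∃ P : MvPolynomial Deg3Monomials ℂ, P ≠ 0 ∧
    ∀ F : MvPolynomial (Fin 5) ℂ, F.IsHomogeneous 3 →
      (∃ p : Fin 5 → ℂ, p j = 1 ∧ ∀ i, eval p (pderiv i F) = 0) →
      eval (fun d : Deg3Monomials => coeff d.1 F) P = 0 := by
  let σ := {i : Fin 5 // i ≠ j}
  let κ := σ ⊕ Sym σ 3 ⊕ Sym σ 2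
  have hσ : Fintype.card σ = 4 := by simp [σ]
  have hκ : Fintype.card κ < 35 := by
    simp only [κ, Fintype.card_sum, Sym.card_sym_eq_choose, hσ]
    decide
  let Y : σ → MvPolynomial (Fin 5) (MvPolynomial κ ℂ) :=
    fun i => X i.1 - C (X (Sum.inl i)) * X j
  obtain ⟨P, hP, h⟩ := exists_elim' hκ
    ((∑ s : Sym σ 3, C (X (Sum.inr (Sum.inl s))) * (s.1.map Y).prod) +
      X j * (∑ s : Sym σ 2, C (X (Sum.inr (Sum.inr s))) * (s.1.map Y).prod))
  refine ⟨P, hP, fun F hF ⟨p, hpj, hp⟩ => ?_⟩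
  obtain ⟨S, hS, hD⟩ := exists_tri F hF
  have hpp : ∀ u, S.T u p p = 0 := by
    intro u
    rw [S.expand1]
    refine Finset.sum_eq_zero fun i _ => ?_
    have := hp i
    rw [hD] at this
    have h3 : S.T (Pi.single i 1) p p = 0 := by simpa using this
    rw [h3, mul_zero]
  let b : σ → Fin 5 → ℂ := fun i => Pi.single i.1 1
  obtain ⟨c3, h3⟩ := S.cubic_form b
  obtain ⟨c2, h2⟩ := quad_collect (fun i i' => 3 * S.T (b i) (b i') p)
  refine h F (Sum.elim (fun i => p i.1) (Sum.elim c3 c2)) fun x => ?_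
  let y : σ → ℂ := fun i => x i.1 - p i.1 * x j
  have hY : ∀ i, eval x (map (eval (Sum.elim (fun i : σ => p i.1) (Sum.elim c3 c2))) (Y i)) = y i := by
    intro i; simp [Y, y]
  have hx : x = (∑ i, y i • b i) + x j • p := by
    ext k
    simp only [Pi.add_apply, Finset.sum_apply, Pi.smul_apply, smul_eq_mul, b]
    by_cases hk : k = j
    · subst hk
      rw [Finset.sum_eq_zero]
      · simp [hpj]
      · intro i _
        rw [Pi.single_eq_of_ne (Ne.symm i.2), mul_zero]
    · rw [Finset.sum_eq_single ⟨k, hk⟩]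
      · simp [y]; ring
      · intro i _ hi
        rw [Pi.single_eq_of_ne, mul_zero]
        intro h; exact hi (Subtype.ext h.symm)
      · simp
  simp only [map_add, map_sum, map_mul, map_C, eval_C, eval_X, map_X, map_multiset_prod,
    Multiset.map_map, Function.comp_def, hY, Sum.elim_inl, Sum.elim_inr]
  rw [← h3, ← h2, hS]
  conv_lhs => rw [hx, S.cube_add]
  rw [S.smul3, S.smul3, S.smul2, S.smul3, S.smul2, S.smul1, hpp, hpp, S.quad_expand b p y]
  simp only [mul_assoc, ← Finset.mul_sum]
  ring

lemma smooth_all : ∃ P : MvPolynomial Deg3Monomials ℂ, P ≠ 0 ∧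
    ∀ F : MvPolynomial (Fin 5) ℂ, F.IsHomogeneous 3 →
      eval (fun d : Deg3Monomials => coeff d.1 F) P ≠ 0 → IsSmoothCubic F := by
  choose P hP h using smooth_chart
  refine ⟨∏ j, P j, Finset.prod_ne_zero_iff.2 fun j _ => hP j, fun F hF hne p hp => ?_⟩
  by_contra hp0
  obtain ⟨j, hj⟩ := Function.ne_iff.1 hp0
  simp only [Pi.zero_apply] at hj
  apply hne
  rw [map_prod]
  refine Finset.prod_eq_zero (Finset.mem_univ j) (h j F hF ⟨(p j)⁻¹ • p, by simp [hj], ?_⟩)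
  intro i
  obtain ⟨S, hS, hD⟩ := exists_tri F hF
  have := hp i
  rw [hD] at this ⊢
  rw [S.smul2, S.smul3]
  linear_combination (p j)⁻¹ * (p j)⁻¹ * this

/-! ### Eckardt points -/

lemma eckardt_chart (j k : Fin 5) (hjk : j ≠ k) : ∃ P : MvPolynomial Deg3Monomials ℂ, P ≠ 0 ∧
    ∀ F : MvPolynomial (Fin 5) ℂ, ∀ S : SymTri, (∀ x, eval x F = S.T x x x) →
      ∀ (p : Fin 5 → ℂ) (A : (Fin 5 → ℂ) →ₗ[ℂ] ℂ), p j = 1 → A (Pi.single k 1) = 1 → A p = 0 →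
        (∀ x y, A x = 0 → A y = 0 → S.T p x y = 0) →
      eval (fun d : Deg3Monomials => coeff d.1 F) P = 0 := by
  let σ := {i : Fin 5 // i ≠ j ∧ i ≠ k}
  let κ := σ ⊕ Fin 5 ⊕ Sym σ 3 ⊕ Sym (Fin 5) 2
  have hσ : Fintype.card σ = 3 := by
    simp only [σ]
    revert j k
    decide
  have hκ : Fintype.card κ < 35 := by
    simp only [κ, Fintype.card_sum, Sym.card_sym_eq_choose, hσ, Fintype.card_fin]
    decide
  let Y : σ → MvPolynomial (Fin 5) (MvPolynomial κ ℂ) :=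
    fun i => X i.1 - C (X (Sum.inl i)) * X j
  obtain ⟨P, hP, h⟩ := exists_elim' hκ
    ((∑ s : Sym σ 3, C (X (Sum.inr (Sum.inr (Sum.inl s)))) * (s.1.map Y).prod) +
      (∑ i : Fin 5, C (X (Sum.inr (Sum.inl i))) * X i) *
      (∑ s : Sym (Fin 5) 2, C (X (Sum.inr (Sum.inr (Sum.inr s)))) * (s.1.map X).prod))
  refine ⟨P, hP, fun F S hS p A hpj hAk hAp hT => ?_⟩
  let e : Fin 5 → ℂ := Pi.single k 1
  let a : Fin 5 → ℂ := fun i => A (Pi.single i 1)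
  have hA : ∀ x, A x = ∑ i, a i * x i := by
    intro x
    conv_lhs => rw [pi_eq_sum_univ' x, map_sum]
    exact Finset.sum_congr rfl fun i _ => by rw [map_smul, smul_eq_mul, mul_comm]
  let b : σ → Fin 5 → ℂ := fun i => Pi.single i.1 1 - a i.1 • e
  have hAb : ∀ i, A (b i) = 0 := by
    intro i; simp [b, e, hAk, a]
  obtain ⟨c3, h3⟩ := S.cubic_form b
  obtain ⟨c2, h2⟩ := quad_collect (fun i i' : Fin 5 =>
    3 * S.T (Pi.single i 1) (Pi.single i' 1) e - 3 * (a i * S.T (Pi.single i' 1) e e)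
      + a i * a i' * S.T e e e)
  let t : κ → ℂ := (Sum.elim (fun i => p i.1) (Sum.elim a (Sum.elim c3 c2)))
  refine h F t fun x => ?_
  let y : σ → ℂ := fun i => x i.1 - p i.1 * x j
  have hY : ∀ i, eval x (map (eval t) (Y i)) = y i := by
    intro i; simp [Y, y, t]
  let z : Fin 5 → ℂ := ∑ i, y i • b i
  have hAz : A z = 0 := by
    simp [z, hAb]
  have hx : x = (z + x j • p) + A x • e := by
    have h0 : A (x - ((z + x j • p) + A x • e)) = 0 := by
      simp [hAz, hAp, e, hAk]
    have hcoord : ∀ i, i ≠ k → (x - ((z + x j • p) + A x • e)) i = 0 := by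
      intro i hik
      simp only [z, b, e, Pi.sub_apply, Pi.add_apply, Finset.sum_apply, Pi.smul_apply, smul_eq_mul,
        Pi.single_eq_of_ne hik, mul_zero, sub_zero, add_zero]
      by_cases hij : i = j
      · subst hij
        rw [Finset.sum_eq_zero]
        · simp [hpj]
        · intro i' _
          rw [Pi.single_eq_of_ne (Ne.symm i'.2.1), mul_zero]
      · rw [Finset.sum_eq_single ⟨i, hij, hik⟩]
        · simp [y]; ring
        · intro i' _ hi
          rw [Pi.single_eq_of_ne, mul_zero]
          intro h; exact hi (Subtype.ext h.symm)
        · simp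
    rw [hA, Finset.sum_eq_single k (fun i _ hi => by rw [hcoord i hi, mul_zero]) (by simp)] at h0
    have hak : a k = 1 := hAk
    rw [hak, one_mul] at h0
    rw [← sub_eq_zero]
    ext i
    by_cases hi : i = k
    · subst hi; exact h0
    · exact hcoord i hi
  have hzp : S.T (z + x j • p) (z + x j • p) (z + x j • p) = S.T z z z := by
    rw [S.cube_add, S.smul3, S.smul3, S.smul2, S.smul3, S.smul2, S.smul1,
      hT p p hAp hAp, S.s13 z z p, hT z z hAz hAz, S.s13 z p p, hT p z hAp hAz]
    ring
  have hm : z + x j • p = x + (- A x) • e := by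
    rw [neg_smul, ← sub_eq_add_neg, eq_sub_iff_add_eq]; exact hx.symm
  simp only [map_add, map_sum, map_mul, map_C, eval_C, eval_X, map_X, map_multiset_prod,
    Multiset.map_map, Function.comp_def, hY]
  simp only [t, Sum.elim_inl, Sum.elim_inr]
  rw [← h3, ← h2, hS, ← hA]
  change _ = S.T z z z + _
  rw [← hzp, hm, S.cube_add]
  have e1 : S.T x x e = ∑ i, ∑ j, S.T (Pi.single i 1) (Pi.single j 1) e * (x i * x j) := by
    rw [← S.quad_expand, ← pi_eq_sum_univ' x]
  have e2 : A x * S.T x e e = ∑ i, ∑ j, (a i * S.T (Pi.single j 1) e e) * (x i * x j) := by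
    rw [hA, S.expand1, Finset.sum_mul_sum]
    exact Finset.sum_congr rfl fun i _ => Finset.sum_congr rfl fun j _ => by ring
  have e3 : A x * A x = ∑ i, ∑ j, (a i * a j) * (x i * x j) := by
    rw [hA, Finset.sum_mul_sum]
    exact Finset.sum_congr rfl fun i _ => Finset.sum_congr rfl fun j _ => by ring
  have e4 : ∑ i, ∑ i', (3 * S.T (Pi.single i 1) (Pi.single i' 1) e -
      3 * (a i * S.T (Pi.single i' 1) e e) + a i * a i' * S.T e e e) * (x i * x i') =
      3 * S.T x x e - 3 * (A x * S.T x e e) + (A x * A x) * S.T e e e := by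
    rw [e1, e2, e3]
    simp only [Finset.mul_sum, Finset.sum_mul, ← Finset.sum_sub_distrib, ← Finset.sum_add_distrib]
    exact Finset.sum_congr rfl fun i _ => Finset.sum_congr rfl fun j _ => by ring
  rw [e4]
  simp only [S.smul1, S.smul2, S.smul3]
  ring

lemma eckardt_all : ∃ P : MvPolynomial Deg3Monomials ℂ, P ≠ 0 ∧
    ∀ F : MvPolynomial (Fin 5) ℂ, ∀ S : SymTri, (∀ x, eval x F = S.T x x x) →
      ∀ (p : Fin 5 → ℂ) (A : (Fin 5 → ℂ) →ₗ[ℂ] ℂ), p ≠ 0 → A ≠ 0 → A p = 0 →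
        (∀ x y, A x = 0 → A y = 0 → S.T p x y = 0) →
      eval (fun d : Deg3Monomials => coeff d.1 F) P = 0 := by
  choose P hP h using eckardt_chart
  refine ⟨∏ q : {q : Fin 5 × Fin 5 // q.1 ≠ q.2}, P q.1.1 q.1.2 q.2,
    Finset.prod_ne_zero_iff.2 fun j _ => hP _ _ _, fun F S hS p A hp hA hAp hT => ?_⟩
  obtain ⟨j, hj⟩ := Function.ne_iff.1 hp
  simp only [Pi.zero_apply] at hj
  have hk : ∃ k, j ≠ k ∧ A (Pi.single k 1) ≠ 0 := by
    by_contra hcon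
    push Not at hcon
    have hx : ∀ x, A x = x j * A (Pi.single j 1) := by
      intro x
      conv_lhs => rw [pi_eq_sum_univ' x, map_sum]
      rw [Finset.sum_eq_single j]
      · simp
      · intro b _ hb
        rw [map_smul, hcon b hb.symm, smul_zero]
      · simp
    have h1 := hx p
    rw [hAp] at h1
    have h2 : A (Pi.single j 1) = 0 := by
      rcases mul_eq_zero.1 h1.symm with h | h
      · exact absurd h hj
      · exact h
    apply hA
    ext x
    simp only [LinearMap.zero_apply, LinearMap.comp_apply]
    rw [hx, h2, mul_zero]
  obtain ⟨k, hjk, hk⟩ := hk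
  rw [map_prod]
  refine Finset.prod_eq_zero (Finset.mem_univ ⟨(j, k), hjk⟩) (h j k hjk F S hS ((p j)⁻¹ • p)
    ((A (Pi.single k 1))⁻¹ • A) ?_ ?_ ?_ ?_)
  · simp [hj]
  · simp [hk]
  · simp [hAp]
  · intro x y hx hy
    rw [S.smul1, hT x y, mul_zero]
    · simpa [hk] using hx
    · simpa [hk] using hy

/-! ### The main family -/

/-- The linear form with given coefficients. -/
def lin {R : Type} [CommRing R] (a : Fin 5 → R) : MvPolynomial (Fin 5) R := ∑ i, C (a i) * X i

/-- The cubic `A R₁² + B R₂² + C R₃² + AB M₁ + AC M₂ + BC M₃`. -/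
def cform {R : Type} [CommRing R] (A : Fin 9 → Fin 5 → R) : MvPolynomial (Fin 5) R :=
  lin (A 0) * lin (A 3) ^ 2 + lin (A 1) * lin (A 4) ^ 2 + lin (A 2) * lin (A 5) ^ 2 +
    lin (A 0) * lin (A 1) * lin (A 6) + lin (A 0) * lin (A 2) * lin (A 7) +
    lin (A 1) * lin (A 2) * lin (A 8)

/-- The value of a linear form. -/
def lv (a x : Fin 5 → ℂ) : ℂ := ∑ i, a i * x i

lemma lv_add (a b x) : lv (a + b) x = lv a x + lv b x := by
  simp [lv, add_mul, Finset.sum_add_distrib]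
lemma lv_smul (k : ℂ) (a x) : lv (k • a) x = k * lv a x := by
  simp [lv, Finset.mul_sum, mul_assoc]
lemma lv_sub (a b x) : lv (a - b) x = lv a x - lv b x := by
  simp [lv, sub_mul, Finset.sum_sub_distrib]

/-- The values of the cubics in the main family. -/
def cval (a b c r s t m n o x : Fin 5 → ℂ) : ℂ :=
  lv a x * lv r x ^ 2 + lv b x * lv s x ^ 2 + lv c x * lv t x ^ 2 +
    lv a x * lv b x * lv m x + lv a x * lv c x * lv n x + lv b x * lv c x * lv o x

lemma eval_map_lin {κ : Type} (a : Fin 5 → MvPolynomial κ ℂ) (t : κ → ℂ) (x) :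
    eval x (map (eval t) (lin a)) = lv (fun i => eval t (a i)) x := by
  simp [lin, lv]

lemma eval_map_cform {κ : Type} (A : Fin 9 → Fin 5 → MvPolynomial κ ℂ) (t : κ → ℂ) (x) :
    eval x (map (eval t) (cform A)) =
      cval (fun i => eval t (A 0 i)) (fun i => eval t (A 1 i)) (fun i => eval t (A 2 i))
        (fun i => eval t (A 3 i)) (fun i => eval t (A 4 i)) (fun i => eval t (A 5 i))
        (fun i => eval t (A 6 i)) (fun i => eval t (A 7 i)) (fun i => eval t (A 8 i)) x := by
  simp only [cform, cval, map_add, map_mul, map_pow, eval_map_lin]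

lemma solve2 (a b c d e f : ℂ) (h : a * d - b * c ≠ 0) :
    ∃ x y : ℂ, a * x + b * y = e ∧ c * x + d * y = f := by
  refine ⟨(e * d - b * f) / (a * d - b * c), (a * f - e * c) / (a * d - b * c), ?_, ?_⟩
  · rw [← mul_div_assoc, ← mul_div_assoc, ← add_div, div_eq_iff h]; ring
  · rw [← mul_div_assoc, ← mul_div_assoc, ← add_div, div_eq_iff h]; ring

/-- First normalization: scaling. -/
lemma norm_step1 (a b c r s t m n o : Fin 5 → ℂ) (ha : a 0 ≠ 0) (hb : b 1 ≠ 0) (hc : c 2 ≠ 0) :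
    ∃ r' s' t' m' n' o' : Fin 5 → ℂ, ∀ x, cval a b c r s t m n o x =
      cval ((a 0)⁻¹ • a) ((b 1)⁻¹ • b) ((c 2)⁻¹ • c) r' s' t' m' n' o' x := by
  obtain ⟨u, hu⟩ := IsAlgClosed.exists_pow_nat_eq (a 0) (n := 2) (by norm_num)
  obtain ⟨v, hv⟩ := IsAlgClosed.exists_pow_nat_eq (b 1) (n := 2) (by norm_num)
  obtain ⟨w, hw⟩ := IsAlgClosed.exists_pow_nat_eq (c 2) (n := 2) (by norm_num)
  refine ⟨u • r, v • s, w • t, (a 0 * b 1) • m, (a 0 * c 2) • n, (b 1 * c 2) • o, fun x => ?_⟩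
  simp only [cval, lv_smul, mul_pow, hu, hv, hw]
  field_simp

/-- Second normalization: `R₁` modulo `B, C`, etc. -/
lemma norm_step2 (a b c r s t m n o : Fin 5 → ℂ)
    (h1 : b 1 * c 2 - c 1 * b 2 ≠ 0) (h2 : a 0 * c 2 - c 0 * a 2 ≠ 0)
    (h3 : a 0 * b 1 - b 0 * a 1 ≠ 0) :
    ∃ r' s' t' m' n' o' : Fin 5 → ℂ, (r' 1 = 0 ∧ r' 2 = 0) ∧ (s' 0 = 0 ∧ s' 2 = 0) ∧
      (t' 0 = 0 ∧ t' 1 = 0) ∧ ∀ x, cval a b c r s t m n o x =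
      cval a b c r' s' t' m' n' o' x := by
  obtain ⟨β, γ, e1, e2⟩ := solve2 (b 1) (c 1) (b 2) (c 2) (r 1) (r 2) h1
  obtain ⟨α', γ', e3, e4⟩ := solve2 (a 0) (c 0) (a 2) (c 2) (s 0) (s 2) h2
  obtain ⟨α'', β'', e5, e6⟩ := solve2 (a 0) (b 0) (a 1) (b 1) (t 0) (t 1) h3
  let r' := r - β • b - γ • c
  let s' := s - α' • a - γ' • c
  let t' := t - α'' • a - β'' • b
  refine ⟨r', s', t',
    m + (2 * β) • r' + β ^ 2 • b + (2 * β * γ) • c + (2 * α') • s' + α' ^ 2 • a + (2 * α' * γ') • c,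
    n + (2 * γ) • r' + γ ^ 2 • c + (2 * α'') • t' + α'' ^ 2 • a + (2 * α'' * β'') • b,
    o + (2 * γ') • s' + γ' ^ 2 • c + (2 * β'') • t' + β'' ^ 2 • b, ⟨?_, ?_⟩, ⟨?_, ?_⟩, ⟨?_, ?_⟩, ?_⟩
  · simp only [r', Pi.sub_apply, Pi.smul_apply, smul_eq_mul]; linear_combination -e1
  · simp only [r', Pi.sub_apply, Pi.smul_apply, smul_eq_mul]; linear_combination -e2
  · simp only [s', Pi.sub_apply, Pi.smul_apply, smul_eq_mul]; linear_combination -e3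
  · simp only [s', Pi.sub_apply, Pi.smul_apply, smul_eq_mul]; linear_combination -e4
  · simp only [t', Pi.sub_apply, Pi.smul_apply, smul_eq_mul]; linear_combination -e5
  · simp only [t', Pi.sub_apply, Pi.smul_apply, smul_eq_mul]; linear_combination -e6
  · intro x
    simp only [cval, r', s', t', lv_add, lv_sub, lv_smul]
    ring

/-- Third normalization: the term `ABC`. -/
lemma norm_step3 (a b c r s t m n o : Fin 5 → ℂ) (hb : b 1 = 1) (hc : c 2 = 1) :
    ∃ m' n' o' : Fin 5 → ℂ, m' 2 = 0 ∧ n' 1 = 0 ∧ ∀ x, cval a b c r s t m n o x =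
      cval a b c r s t m' n' o' x := by
  refine ⟨m - m 2 • c, n - n 1 • b, o + (m 2 + n 1) • a, by simp [hc], by simp [hb], fun x => ?_⟩
  simp only [cval, lv_add, lv_sub, lv_smul]
  ring

/-- The normalized family, with 34 parameters. -/
def slice : Fin 9 → Fin 5 → MvPolynomial (Fin 34) ℂ :=
  ![![1, X 0, X 1, X 2, X 3], ![X 4, 1, X 5, X 6, X 7], ![X 8, X 9, 1, X 10, X 11],
    ![X 12, 0, 0, X 13, X 14], ![0, X 15, 0, X 16, X 17], ![0, 0, X 18, X 19, X 20],
    ![X 21, X 22, 0, X 23, X 24], ![X 25, 0, X 26, X 27, X 28], ![X 29, X 30, X 31, X 32, X 33]]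

lemma slice_surj (a b c r s t m n o : Fin 5 → ℂ) (ha : a 0 = 1) (hb : b 1 = 1) (hc : c 2 = 1)
    (hr1 : r 1 = 0) (hr2 : r 2 = 0) (hs0 : s 0 = 0) (hs2 : s 2 = 0) (ht0 : t 0 = 0)
    (ht1 : t 1 = 0) (hm : m 2 = 0) (hn : n 1 = 0) :
    ∃ q : Fin 34 → ℂ, ∀ x, cval a b c r s t m n o x = eval x (map (eval q) (cform slice)) := by
  refine ⟨![a 1, a 2, a 3, a 4, b 0, b 2, b 3, b 4, c 0, c 1, c 3, c 4, r 0, r 3, r 4,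
    s 1, s 3, s 4, t 2, t 3, t 4, m 0, m 1, m 3, m 4, n 0, n 2, n 3, n 4,
    o 0, o 1, o 2, o 3, o 4], fun x => ?_⟩
  rw [eval_map_cform]
  congr 1 <;> ext i <;> fin_cases i <;> simp [slice, *]

lemma main_family : ∃ P : MvPolynomial Deg3Monomials ℂ, P ≠ 0 ∧
    ∀ F : MvPolynomial (Fin 5) ℂ,
      (∃ a b c r s t m n o : Fin 5 → ℂ, ∀ x, eval x F = cval a b c r s t m n o x) →
      eval (fun d : Deg3Monomials => coeff d.1 F) P = 0 := by
  obtain ⟨P, hP, h⟩ := exists_elim' (κ := Fin 34) (by simp) (cform slice)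
  refine ⟨P, hP, ?_⟩
  let full : Fin 9 → Fin 5 → MvPolynomial (Fin 9 × Fin 5) ℂ := fun i j => X (i, j)
  let Q := aeval (fun d : Deg3Monomials => coeff d.1 (cform full)) P
  let D : MvPolynomial (Fin 9 × Fin 5) ℂ :=
    X (0, 0) * X (1, 1) * X (2, 2) * (X (1, 1) * X (2, 2) - X (2, 1) * X (1, 2)) *
    (X (0, 0) * X (2, 2) - X (2, 0) * X (0, 2)) * (X (0, 0) * X (1, 1) - X (1, 0) * X (0, 1))
  have hD : D ≠ 0 := by
    intro h0
    have := congrArg (eval (fun q : Fin 9 × Fin 5 => if q.1.1 = q.2.1 then (1 : ℂ) else 0)) h0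
    simp [D] at this
  have hDQ : D * Q = 0 := by
    apply MvPolynomial.funext
    intro q
    rw [map_mul, map_zero]
    by_cases hq : eval q D = 0
    · rw [hq, zero_mul]
    · rw [eval_aeval_coeff]
      simp only [D, map_mul, map_sub, eval_X, mul_eq_zero, not_or] at hq
      obtain ⟨⟨⟨⟨⟨ha, hb⟩, hc⟩, h1⟩, h2⟩, h3⟩ := hq
      obtain ⟨r, s, t, m, n, o, e1⟩ := norm_step1 (fun i => q (0, i)) (fun i => q (1, i))
        (fun i => q (2, i)) (fun i => q (3, i)) (fun i => q (4, i)) (fun i => q (5, i))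
        (fun i => q (6, i)) (fun i => q (7, i)) (fun i => q (8, i)) ha hb hc
      generalize haa : (q (0, 0))⁻¹ • (fun i => q (0, i)) = a at e1
      generalize hbb : (q (1, 1))⁻¹ • (fun i => q (1, i)) = b at e1
      generalize hcc : (q (2, 2))⁻¹ • (fun i => q (2, i)) = c at e1
      have ha' : a 0 = 1 := by subst haa; simp [ha]
      have hb' : b 1 = 1 := by subst hbb; simp [hb]
      have hc' : c 2 = 1 := by subst hcc; simp [hc]
      obtain ⟨r, s, t, m, n, o, ⟨hr1, hr2⟩, ⟨hs0, hs2⟩, ⟨ht0, ht1⟩, e2⟩ :=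
        norm_step2 a b c r s t m n o
        (by
          intro h0; apply h1; subst hbb hcc
          simp only [Pi.smul_apply, smul_eq_mul] at h0
          field_simp at h0; rwa [mul_zero] at h0)
        (by
          intro h0; apply h2; subst haa hcc
          simp only [Pi.smul_apply, smul_eq_mul] at h0
          field_simp at h0; rwa [mul_zero] at h0)
        (by
          intro h0; apply h3; subst haa hbb
          simp only [Pi.smul_apply, smul_eq_mul] at h0
          field_simp at h0; rwa [mul_zero] at h0)
      obtain ⟨m, n, o, hm, hn, e3⟩ := norm_step3 a b c r s t m n o hb' hc'
      obtain ⟨q', e4⟩ := slice_surj a b c r s t m n o ha' hb' hc' hr1 hr2 hs0 hs2 ht0 ht1 hm hn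
      rw [h _ q' (fun x => ?_), mul_zero]
      rw [← e4, ← e3, ← e2, ← e1, eval_map_cform]
      simp [full]
  have hQ : Q = 0 := (mul_eq_zero.1 hDQ).resolve_left hD
  rintro F ⟨a, b, c, r, s, t, m, n, o, hF⟩
  let q : Fin 9 × Fin 5 → ℂ := fun i => (![a, b, c, r, s, t, m, n, o] : Fin 9 → Fin 5 → ℂ) i.1 i.2
  have : F = map (eval q) (cform full) := by
    apply MvPolynomial.funext
    intro x
    rw [hF, eval_map_cform]
    simp [full, q]
  rw [this, ← eval_aeval_coeff]
  change eval q Q = 0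
  rw [hQ, map_zero]

/-! ### Geometry -/

/-- The restriction of the cubic to the plane spanned by `l` and `v` is `a k R²`. -/
def PlaneData (S : SymTri) (l : Submodule ℂ (Fin 5 → ℂ)) (v : Fin 5 → ℂ) (k : ℂ)
    (R : (Fin 5 → ℂ) →ₗ[ℂ] ℂ) : Prop :=
  ∀ w ∈ l, ∀ a : ℂ, S.T (w + a • v) (w + a • v) (w + a • v) = a * k * R (w + a • v) ^ 2

lemma PlaneData.change {S : SymTri} {l : Submodule ℂ (Fin 5 → ℂ)} {v : Fin 5 → ℂ} {k : ℂ}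
    {R : (Fin 5 → ℂ) →ₗ[ℂ] ℂ} (h : PlaneData S l v k R) (c : ℂ) (w₀ : Fin 5 → ℂ) (hw₀ : w₀ ∈ l) :
    PlaneData S l (c • v + w₀) (c * k) R := by
  intro w hw a
  have := h (w + a • w₀) (l.add_mem hw (l.smul_mem a hw₀)) (a * c)
  have e : w + a • w₀ + (a * c) • v = w + a • (c • v + w₀) := by module
  rw [e] at this
  rw [this]; ring

lemma cycle_data {F : MvPolynomial (Fin 5) ℂ} {S : SymTri} (hS : ∀ x, eval x F = S.T x x x)
    {l r Pl : Submodule ℂ (Fin 5 → ℂ)} (h : CycleLplus2R F l r Pl) :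
    ∃ (v : Fin 5 → ℂ) (k : ℂ) (R : (Fin 5 → ℂ) →ₗ[ℂ] ℂ), k ≠ 0 ∧ v ∈ Pl ∧ v ∉ l ∧
      (∀ x ∈ Pl, ∃ a : ℂ, x - a • v ∈ l) ∧ PlaneData S l v k R ∧ Pl ⊓ LinearMap.ker R = r := by
  obtain ⟨_, _, _, hlP, _, _, c, L, R, hc, ⟨v, hvP, hLv⟩, _, hL, hR, hF⟩ := h
  have hLl : ∀ w ∈ l, L w = 0 := by
    intro w hw
    rw [← hL] at hw
    exact hw.2
  refine ⟨v, c * L v, R, mul_ne_zero hc hLv, hvP, fun hv => hLv (hLl v hv), ?_, ?_, hR⟩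
  · intro x hx
    refine ⟨L x / L v, ?_⟩
    rw [← hL]
    refine ⟨Pl.sub_mem hx (Pl.smul_mem _ hvP), ?_⟩
    rw [SetLike.mem_coe, LinearMap.mem_ker, map_sub, map_smul, smul_eq_mul, div_mul_cancel₀ _ hLv, sub_self]
  · intro w hw a
    rw [← hS, hF _ (Pl.add_mem (hlP hw) (Pl.smul_mem a hvP)), map_add L, hLl w hw, map_smul]
    simp only [smul_eq_mul]
    ring

lemma planes_indep {S : SymTri} {l r₁ r₂ Pl₁ Pl₂ : Submodule ℂ (Fin 5 → ℂ)}
    (hl : IsLine l) (hr₁ : IsLine r₁) (hr₂ : IsLine r₂) (hrl : r₁ ≠ l) (hne : r₁ ≠ r₂)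
    {v₁ v₂ : Fin 5 → ℂ} {k₁ k₂ : ℂ} {R₁ R₂ : (Fin 5 → ℂ) →ₗ[ℂ] ℂ}
    (hlP : l ≤ Pl₂) (hk₂ : k₂ ≠ 0) (hv₁ : v₁ ∉ l)
    (hvP : v₂ ∈ Pl₂) (hv₂ : v₂ ∉ l) (hP₁ : ∀ x ∈ Pl₁, ∃ a : ℂ, x - a • v₁ ∈ l)
    (h₁ : PlaneData S l v₁ k₁ R₁) (h₂ : PlaneData S l v₂ k₂ R₂)
    (hR₁ : Pl₁ ⊓ LinearMap.ker R₁ = r₁) (hR₂ : Pl₂ ⊓ LinearMap.ker R₂ = r₂) :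
    ∀ a b : ℂ, a • v₁ + b • v₂ ∈ l → a = 0 ∧ b = 0 := by
  intro a b hab
  by_contra hcon
  have ha : a ≠ 0 := by
    rintro rfl
    rw [zero_smul, zero_add] at hab
    by_cases hb : b = 0
    · exact hcon ⟨rfl, hb⟩
    · exact hv₂ ((l.smul_mem_iff hb).1 hab)
  have hb : b ≠ 0 := by
    rintro rfl
    rw [zero_smul, add_zero] at hab
    exact hv₁ ((l.smul_mem_iff ha).1 hab)
  have key : ∀ x ∈ r₁, x ∉ l → x ∈ r₂ := by
    intro x hx hxl
    rw [← hR₁] at hx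
    obtain ⟨c, hc⟩ := hP₁ x hx.1
    have hc0 : c ≠ 0 := by
      rintro rfl
      rw [zero_smul, sub_zero] at hc
      exact hxl hc
    have e1 := h₁ _ hc c
    rw [sub_add_cancel, LinearMap.mem_ker.1 hx.2] at e1
    let w := x + (c * a⁻¹ * b) • v₂
    have hw : w ∈ l := by
      have : w = (x - c • v₁) + (c * a⁻¹) • (a • v₁ + b • v₂) := by
        simp only [w, smul_add, smul_smul, mul_assoc, inv_mul_cancel₀ ha, mul_one]
        module
      rw [this]
      exact l.add_mem hc (l.smul_mem _ hab)
    have e2 := h₂ w hw (-(c * a⁻¹ * b))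
    have e3 : w + (-(c * a⁻¹ * b)) • v₂ = x := by simp only [w]; module
    rw [e3, e1] at e2
    rw [← hR₂]
    refine ⟨?_, ?_⟩
    · rw [← e3]; exact Pl₂.add_mem (hlP hw) (Pl₂.smul_mem _ hvP)
    · rw [SetLike.mem_coe, LinearMap.mem_ker]
      have h0 : -(c * a⁻¹ * b) * k₂ ≠ 0 :=
        mul_ne_zero (neg_ne_zero.2 (mul_ne_zero (mul_ne_zero hc0 (inv_ne_zero ha)) hb)) hk₂
      have e4 : -(c * a⁻¹ * b) * k₂ * R₂ x ^ 2 = 0 := by rw [← e2]; ring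
      exact pow_eq_zero_iff (two_ne_zero) |>.1 ((mul_eq_zero.1 e4).resolve_left h0)
  obtain ⟨y, hy, hyl⟩ : ∃ y ∈ r₁, y ∉ l := by
    by_contra hno
    push Not at hno
    exact hrl (Submodule.eq_of_le_of_finrank_eq hno (hr₁.trans hl.symm))
  apply hne
  refine Submodule.eq_of_le_of_finrank_eq (fun x hx => ?_) (hr₁.trans hr₂.symm)
  by_cases hxl : x ∈ l
  · have h5 : x + y ∈ r₂ := key _ (r₁.add_mem hx hy) (fun h => hyl ((l.add_mem_iff_right hxl).1 h))
    exact (r₂.add_mem_iff_left (key y hy hyl)).1 h5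
  · exact key x hx hxl

lemma exists_coords {l : Submodule ℂ (Fin 5 → ℂ)} (hl : IsLine l) (v₁ v₂ u : Fin 5 → ℂ)
    (h : ∀ a b : ℂ, a • v₁ + b • v₂ ∈ l → a = 0 ∧ b = 0)
    (hu : ∀ a b : ℂ, u - a • v₁ - b • v₂ ∉ l) :
    ∃ A B C : (Fin 5 → ℂ) →ₗ[ℂ] ℂ, (∀ x, x - A x • v₁ - B x • v₂ - C x • u ∈ l) ∧
      (∀ w ∈ l, C w = 0) ∧ C u = 1 := by
  have hfr : Module.finrank ℂ ((Fin 5 → ℂ) ⧸ l) = 3 := by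
    have := l.finrank_quotient_add_finrank
    rw [hl] at this
    simp at this
    omega
  let b : Fin 3 → (Fin 5 → ℂ) ⧸ l := ![l.mkQ v₁, l.mkQ v₂, l.mkQ u]
  have hb : LinearIndependent ℂ b := by
    rw [Fintype.linearIndependent_iff]
    intro g hg
    simp only [Fin.sum_univ_three, b, Matrix.cons_val_zero, Matrix.cons_val_one,
      Matrix.cons_val] at hg
    rw [← map_smul, ← map_smul, ← map_smul, ← map_add, ← map_add, Submodule.mkQ_apply,
      Submodule.Quotient.mk_eq_zero] at hg
    have g2 : g 2 = 0 := by
      by_contra h2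
      apply hu (-((g 2)⁻¹ * g 0)) (-((g 2)⁻¹ * g 1))
      have := l.smul_mem (g 2)⁻¹ hg
      rw [smul_add, smul_add, smul_smul _ (g 2), inv_mul_cancel₀ h2, one_smul] at this
      convert this using 1
      module
    rw [g2, zero_smul, add_zero] at hg
    obtain ⟨g0, g1⟩ := h _ _ hg
    intro i
    fin_cases i
    · exact g0
    · exact g1
    · exact g2
  let β := basisOfLinearIndependentOfCardEqFinrank hb (by simp [hfr])
  have hβ : ∀ i, β i = b i := fun i => by simp [β]
  refine ⟨β.coord 0 ∘ₗ l.mkQ, β.coord 1 ∘ₗ l.mkQ, β.coord 2 ∘ₗ l.mkQ, ?_, ?_, ?_⟩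
  · intro x
    rw [← Submodule.Quotient.mk_eq_zero, ← Submodule.mkQ_apply]
    have := β.sum_repr (l.mkQ x)
    simp only [Fin.sum_univ_three, hβ] at this
    simp only [b, Matrix.cons_val_zero, Matrix.cons_val_one, Matrix.cons_val] at this
    simp only [map_sub, map_smul, LinearMap.comp_apply, Module.Basis.coord_apply]
    nth_rewrite 1 [← this]
    abel
  · intro w hw
    have : l.mkQ w = 0 := by rwa [Submodule.mkQ_apply, Submodule.Quotient.mk_eq_zero]
    rw [LinearMap.comp_apply, this, map_zero]
  · have : l.mkQ u = β 2 := by rw [hβ]; rfl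
    rw [LinearMap.comp_apply, this, Module.Basis.coord_apply, Module.Basis.repr_self]
    simp

lemma exists_outside {l : Submodule ℂ (Fin 5 → ℂ)} (hl : IsLine l) (v₁ v₂ : Fin 5 → ℂ) :
    ∃ u : Fin 5 → ℂ, ∀ a b : ℂ, u - a • v₁ - b • v₂ ∉ l := by
  by_contra hcon
  push Not at hcon
  have htop : l ⊔ Submodule.span ℂ {v₁, v₂} = ⊤ := by
    rw [eq_top_iff]
    intro u _
    obtain ⟨a, b, hab⟩ := hcon u
    rw [Submodule.mem_sup]
    refine ⟨_, hab, a • v₁ + b • v₂, Submodule.mem_span_pair.2 ⟨a, b, rfl⟩, ?_⟩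
    module
  have h1 := Submodule.finrank_add_le_finrank_add_finrank l (Submodule.span ℂ {v₁, v₂})
  have h2 : Module.finrank ℂ (Submodule.span ℂ ({v₁, v₂} : Set (Fin 5 → ℂ))) ≤ 2 := by
    have := finrank_span_finset_le_card (R := ℂ) ({v₁, v₂} : Finset (Fin 5 → ℂ))
    rw [Finset.coe_pair] at this
    exact this.trans Finset.card_le_two
  rw [htop, hl, finrank_top] at h1
  simp at h1
  omega

lemma exists_ker {l : Submodule ℂ (Fin 5 → ℂ)} (hl : IsLine l) (R : (Fin 5 → ℂ) →ₗ[ℂ] ℂ) :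
    ∃ w ∈ l, w ≠ 0 ∧ R w = 0 := by
  have := LinearMap.ker_ne_bot_of_finrank_lt (f := R.domRestrict l)
    (by rw [hl]; simp)
  obtain ⟨w, hw, hw0⟩ := Submodule.exists_mem_ne_zero_of_ne_bot this
  exact ⟨w.1, w.2, fun h => hw0 (Subtype.ext h), hw⟩

/-- The coefficient vector of a linear form. -/
def cv (A : (Fin 5 → ℂ) →ₗ[ℂ] ℂ) : Fin 5 → ℂ := fun i => A (Pi.single i 1)

lemma lv_cv (A : (Fin 5 → ℂ) →ₗ[ℂ] ℂ) (x) : lv (cv A) x = A x := by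
  conv_rhs => rw [pi_eq_sum_univ' x, map_sum]
  exact Finset.sum_congr rfl fun i _ => by rw [map_smul, smul_eq_mul, mul_comm]; rfl

lemma lv_T (S : SymTri) (u v x) : lv (fun i => S.T u v (Pi.single i 1)) x = S.T u v x := by
  rw [S.expand3, lv]
  exact Finset.sum_congr rfl fun i _ => mul_comm _ _

lemma general_position {S : SymTri} {l : Submodule ℂ (Fin 5 → ℂ)} (h0 : ∀ w ∈ l, S.T w w w = 0)
    {v₁ v₂ v₃ : Fin 5 → ℂ} {k₁ k₂ k₃ : ℂ} {R₁ R₂ R₃ : (Fin 5 → ℂ) →ₗ[ℂ] ℂ}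
    (h₁ : PlaneData S l v₁ k₁ R₁) (h₂ : PlaneData S l v₂ k₂ R₂) (h₃ : PlaneData S l v₃ k₃ R₃)
    (A B C : (Fin 5 → ℂ) →ₗ[ℂ] ℂ) (hx : ∀ x, x - A x • v₁ - B x • v₂ - C x • v₃ ∈ l) :
    ∃ a b c r s t m n o : Fin 5 → ℂ, ∀ x, S.T x x x = cval a b c r s t m n o x := by
  obtain ⟨d₁, hd₁⟩ := IsAlgClosed.exists_pow_nat_eq k₁ (n := 2) (by norm_num)
  obtain ⟨d₂, hd₂⟩ := IsAlgClosed.exists_pow_nat_eq k₂ (n := 2) (by norm_num)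
  obtain ⟨d₃, hd₃⟩ := IsAlgClosed.exists_pow_nat_eq k₃ (n := 2) (by norm_num)
  refine ⟨cv A, cv B, cv C,
    d₁ • cv (R₁ ∘ₗ (LinearMap.id - B.smulRight v₂ - C.smulRight v₃)),
    d₂ • cv (R₂ ∘ₗ (LinearMap.id - A.smulRight v₁ - C.smulRight v₃)),
    d₃ • cv (R₃ ∘ₗ (LinearMap.id - A.smulRight v₁ - B.smulRight v₂)),
    (6 : ℂ) • (fun i => S.T v₁ v₂ (Pi.single i 1)) + (-3 * S.T v₁ v₁ v₂) • cv A
      + (-3 * S.T v₁ v₂ v₂) • cv B,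
    (6 : ℂ) • (fun i => S.T v₁ v₃ (Pi.single i 1)) + (-3 * S.T v₁ v₁ v₃) • cv A
      + (-6 * S.T v₁ v₂ v₃) • cv B + (-3 * S.T v₁ v₃ v₃) • cv C,
    (6 : ℂ) • (fun i => S.T v₂ v₃ (Pi.single i 1)) + (-6 * S.T v₁ v₂ v₃) • cv A
      + (-3 * S.T v₂ v₂ v₃) • cv B + (-3 * S.T v₂ v₃ v₃) • cv C, fun x => ?_⟩
  simp only [cval, lv_add, lv_smul, lv_cv, lv_T, mul_pow, hd₁, hd₂, hd₃, LinearMap.comp_apply,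
    LinearMap.sub_apply, LinearMap.id_apply, LinearMap.smulRight_apply]
  have hw := hx x
  generalize A x = α at *
  generalize B x = β at *
  generalize C x = γ at *
  generalize hwd : x - α • v₁ - β • v₂ - γ • v₃ = w at *
  have e1 : x - β • v₂ - γ • v₃ = w + α • v₁ := by rw [← hwd]; module
  have e2 : x - α • v₁ - γ • v₃ = w + β • v₂ := by rw [← hwd]; module
  have e3 : x - α • v₁ - β • v₂ = w + γ • v₃ := by rw [← hwd]; module
  have e4 : x = w + α • v₁ + β • v₂ + γ • v₃ := by rw [← hwd]; module
  rw [e1, e2, e3, e4]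
  have f0 := h0 w hw
  have f1 := h₁ w hw α
  have f2 := h₂ w hw β
  have f3 := h₃ w hw γ
  generalize R₁ (w + α • v₁) = ρ₁ at *
  generalize R₂ (w + β • v₂) = ρ₂ at *
  generalize R₃ (w + γ • v₃) = ρ₃ at *
  clear e1 e2 e3 e4 hwd hx h₁ h₂ h₃ hw
  simp only [S.add1, S.add2, S.add3, S.smul1, S.smul2, S.smul3] at f1 f2 f3 ⊢
  simp only [S.s12, S.s23] at f0 f1 f2 f3 ⊢
  linear_combination f1 + f2 + f3 - 2 * f0

lemma PlaneData.coeffs {S : SymTri} {l : Submodule ℂ (Fin 5 → ℂ)} (h0 : ∀ w ∈ l, S.T w w w = 0)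
    {v : Fin 5 → ℂ} {k : ℂ} {R : (Fin 5 → ℂ) →ₗ[ℂ] ℂ} (h : PlaneData S l v k R) (w) (hw : w ∈ l) :
    3 * S.T w w v = k * R w ^ 2 ∧ 3 * S.T w v v = 2 * k * R w * R v := by
  have e0 := h0 w hw
  have e1 := h w hw 1
  have e2 := h w hw (-1)
  have e3 := h w hw 2
  simp only [S.cube_add, S.smul1, S.smul2, S.smul3, map_add, map_smul, smul_eq_mul, e0]
    at e1 e2 e3
  constructor
  · linear_combination e1 - (1 / 3) * e2 - (1 / 6) * e3
  · linear_combination (1 / 2) * e1 + (1 / 2) * e2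

lemma PlaneData.polar {S : SymTri} {l : Submodule ℂ (Fin 5 → ℂ)} (h0 : ∀ w ∈ l, S.T w w w = 0)
    {v : Fin 5 → ℂ} {k : ℂ} {R : (Fin 5 → ℂ) →ₗ[ℂ] ℂ} (h : PlaneData S l v k R) (p) (hp : p ∈ l)
    (hRp : R p = 0) : (∀ w ∈ l, S.T p w v = 0) ∧ S.T p v v = 0 := by
  constructor
  · intro w hw
    have e1 := (h.coeffs h0 (p + w) (l.add_mem hp hw)).1
    have e2 := (h.coeffs h0 p hp).1
    have e3 := (h.coeffs h0 w hw).1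
    simp only [S.add1, S.add2, map_add, hRp] at e1 e2
    rw [S.s12 w p v] at e1
    linear_combination (1 / 6) * e1 - (1 / 6) * e2 - (1 / 6) * e3
  · have e2 := (h.coeffs h0 p hp).2
    rw [hRp] at e2
    linear_combination (1 / 3) * e2

lemma line_polar {S : SymTri} {l : Submodule ℂ (Fin 5 → ℂ)} (h0 : ∀ w ∈ l, S.T w w w = 0) :
    ∀ u ∈ l, ∀ v ∈ l, ∀ w ∈ l, S.T u v w = 0 := by
  have h1 : ∀ u ∈ l, ∀ v ∈ l, S.T u u v = 0 := by
    intro u hu v hv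
    have e1 := h0 _ (l.add_mem hu hv)
    have e2 := h0 _ (l.add_mem hu (l.smul_mem (-1) hv))
    simp only [S.cube_add, S.smul1, S.smul2, S.smul3, h0 u hu, h0 v hv] at e1 e2
    linear_combination (1 / 6) * e1 - (1 / 6) * e2
  intro u hu v hv w hw
  have e1 := h1 _ (l.add_mem hu hv) w hw
  simp only [S.add1, S.add2, h1 u hu w hw, h1 v hv w hw, S.s12 v u] at e1
  linear_combination (1 / 2) * e1

lemma special_position {S : SymTri} {l : Submodule ℂ (Fin 5 → ℂ)} (hl : IsLine l)
    (h0 : ∀ w ∈ l, S.T w w w = 0)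
    {v₁ v₂ : Fin 5 → ℂ} {k₁ k₂ k₃ : ℂ} {R₁ R₂ R₃ : (Fin 5 → ℂ) →ₗ[ℂ] ℂ}
    (hk₁ : k₁ ≠ 0) (hk₂ : k₂ ≠ 0) (hk₃ : k₃ ≠ 0)
    (h₁ : PlaneData S l v₁ k₁ R₁) (h₂ : PlaneData S l v₂ k₂ R₂)
    (h₃ : PlaneData S l (v₁ + v₂) k₃ R₃) :
    ∃ p ∈ l, p ≠ 0 ∧ ∀ w ∈ l, ∀ w' ∈ l, ∀ a b a' b' : ℂ,
      S.T p (w + a • v₁ + b • v₂) (w' + a' • v₁ + b' • v₂) = 0 := by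
  have hq : ∀ w ∈ l, k₁ * R₁ w ^ 2 + k₂ * R₂ w ^ 2 = k₃ * R₃ w ^ 2 := by
    intro w hw
    rw [← (h₁.coeffs h0 w hw).1, ← (h₂.coeffs h0 w hw).1, ← (h₃.coeffs h0 w hw).1, S.add3]
    ring
  have hp : ∃ p ∈ l, p ≠ 0 ∧ R₁ p = 0 ∧ R₂ p = 0 ∧ R₃ p = 0 := by
    obtain ⟨w₀, hw₀, hne, hR⟩ := exists_ker hl R₃
    have e0 := hq w₀ hw₀
    rw [hR] at e0
    by_cases h1 : R₁ w₀ = 0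
    · refine ⟨w₀, hw₀, hne, h1, ?_, hR⟩
      have : k₂ * R₂ w₀ ^ 2 = 0 := by rw [h1] at e0; linear_combination e0
      exact pow_eq_zero_iff two_ne_zero |>.1 ((mul_eq_zero.1 this).resolve_left hk₂)
    · obtain ⟨w₁, hw₁, hne₁, hR₁⟩ := exists_ker hl R₁
      have e1 := hq w₁ hw₁
      have e2 := hq _ (l.add_mem hw₀ hw₁)
      simp only [map_add, hR, hR₁] at e1 e2
      have e3 : k₂ * (R₂ w₀ * R₂ w₁) = 0 := by
        linear_combination (1 / 2) * e2 - (1 / 2) * e1 - (1 / 2) * e0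
      have hk₁R : R₂ w₁ = 0 ∨ R₂ w₀ = 0 := by
        rcases mul_eq_zero.1 e3 with h | h
        · exact absurd h hk₂
        · exact (mul_eq_zero.1 h).symm
      have hR₂ : R₂ w₁ = 0 := by
        rcases hk₁R with h | h
        · exact h
        · exfalso
          rw [h] at e0
          have : k₁ * R₁ w₀ ^ 2 = 0 := by linear_combination e0
          exact mul_ne_zero hk₁ (pow_ne_zero 2 h1) this
      refine ⟨w₁, hw₁, hne₁, hR₁, hR₂, ?_⟩
      rw [hR₂] at e1
      have : k₃ * R₃ w₁ ^ 2 = 0 := by linear_combination -e1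
      exact pow_eq_zero_iff two_ne_zero |>.1 ((mul_eq_zero.1 this).resolve_left hk₃)
  obtain ⟨p, hpl, hp0, p1, p2, p3⟩ := hp
  refine ⟨p, hpl, hp0, ?_⟩
  obtain ⟨q1, q1'⟩ := h₁.polar h0 p hpl p1
  obtain ⟨q2, q2'⟩ := h₂.polar h0 p hpl p2
  obtain ⟨q3, q3'⟩ := h₃.polar h0 p hpl p3
  have q12 : S.T p v₁ v₂ = 0 := by
    simp only [S.add2, S.add3, q1', q2', S.s23 p v₂ v₁] at q3'
    linear_combination (1 / 2) * q3'
  intro w hw w' hw' a b a' b'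
  simp only [S.add2, S.add3, S.smul2, S.smul3, line_polar h0 p hpl w hw w' hw', q1 w hw, q2 w hw,
    S.s23 p v₁ w', S.s23 p v₂ w', q1 w' hw', q2 w' hw', q1', q2', S.s23 p v₂ v₁, q12]
  ring

/-- For a general smooth cubic threefold `V ⊂ ℙ⁴`, there is no line `l` on `V`
admitting three pairwise distinct residual double lines: no pairwise distinct
`r₁, r₂, r₃` on `V` and 2-planes `π₁, π₂, π₃` with `V·πᵢ = l + 2rᵢ`. -/
theorem general_cubic_no_line_with_three_residual_double_lines :
    ∃ P : MvPolynomial Deg3Monomials ℂ, P ≠ 0 ∧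
      ∀ F : MvPolynomial (Fin 5) ℂ, F.IsHomogeneous 3 →
        eval (fun d : Deg3Monomials => F.coeff d.1) P ≠ 0 →
        IsSmoothCubic F ∧
        ¬∃ l r₁ r₂ r₃ Pl₁ Pl₂ Pl₃ : Submodule ℂ (Fin 5 → ℂ),
          r₁ ≠ r₂ ∧ r₁ ≠ r₃ ∧ r₂ ≠ r₃ ∧
          LiesOn F l ∧ LiesOn F r₁ ∧ LiesOn F r₂ ∧ LiesOn F r₃ ∧
          CycleLplus2R F l r₁ Pl₁ ∧ CycleLplus2R F l r₂ Pl₂ ∧ CycleLplus2R F l r₃ Pl₃ := by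
  obtain ⟨P₁, hP₁, h₁⟩ := smooth_all
  obtain ⟨P₂, hP₂, h₂⟩ := eckardt_all
  obtain ⟨P₃, hP₃, h₃⟩ := main_family
  refine ⟨P₁ * P₂ * P₃, mul_ne_zero (mul_ne_zero hP₁ hP₂) hP₃, fun F hF hne => ?_⟩
  rw [map_mul, map_mul] at hne
  have n₁ := left_ne_zero_of_mul (left_ne_zero_of_mul hne)
  have n₂ := right_ne_zero_of_mul (left_ne_zero_of_mul hne)
  have n₃ := right_ne_zero_of_mul hne
  refine ⟨h₁ F hF n₁, ?_⟩
  rintro ⟨l, r₁, r₂, r₃, Pl₁, Pl₂, Pl₃, h12, h13, h23, hFl, -, -, -, c₁, c₂, c₃⟩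
  obtain ⟨S, hS, -⟩ := exists_tri F hF
  have h0 : ∀ w ∈ l, S.T w w w = 0 := fun w hw => by rw [← hS]; exact hFl w hw
  obtain ⟨v₁, k₁, R₁, hk₁, hvP₁, hv₁, hPl₁, hd₁, hr₁⟩ := cycle_data hS c₁
  obtain ⟨v₂, k₂, R₂, hk₂, hvP₂, hv₂, hPl₂, hd₂, hr₂⟩ := cycle_data hS c₂
  obtain ⟨v₃, k₃, R₃, hk₃, hvP₃, hv₃, hPl₃, hd₃, hr₃⟩ := cycle_data hS c₃
  obtain ⟨hl, hrl₁, -, hlP₁, -, hne₁, -⟩ := c₁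
  obtain ⟨-, hrl₂, -, hlP₂, -, hne₂, -⟩ := c₂
  obtain ⟨-, hrl₃, -, hlP₃, -, hne₃, -⟩ := c₃
  have i12 := planes_indep hl hrl₁ hrl₂ hne₁ h12 hlP₂ hk₂ hv₁ hvP₂ hv₂ hPl₁ hd₁ hd₂ hr₁ hr₂
  have i13 := planes_indep hl hrl₁ hrl₃ hne₁ h13 hlP₃ hk₃ hv₁ hvP₃ hv₃ hPl₁ hd₁ hd₃ hr₁ hr₃
  have i23 := planes_indep hl hrl₂ hrl₃ hne₂ h23 hlP₃ hk₃ hv₂ hvP₃ hv₃ hPl₂ hd₂ hd₃ hr₂ hr₃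
  by_cases hcase : ∀ a b : ℂ, v₃ - a • v₁ - b • v₂ ∉ l
  · -- the three planes span the whole space
    obtain ⟨A, B, D, hx, -, -⟩ := exists_coords hl v₁ v₂ v₃ i12 hcase
    obtain ⟨a, b, c, r, s, t, m, n, o, hc⟩ := general_position h0 hd₁ hd₂ hd₃ A B D hx
    exact n₃ (h₃ F ⟨a, b, c, r, s, t, m, n, o, fun x => by rw [hS, hc]⟩)
  · -- the three planes lie in a hyperplane
    push Not at hcase
    obtain ⟨α, β, hab⟩ := hcase
    have hα : α ≠ 0 := by
      rintro rfl
      have := (i23 (-β) 1 (by convert hab using 1; module)).2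
      exact one_ne_zero this
    have hβ : β ≠ 0 := by
      rintro rfl
      have := (i13 (-α) 1 (by convert hab using 1; module)).2
      exact one_ne_zero this
    have d₁ := hd₁.change α 0 l.zero_mem
    have d₂ := hd₂.change β 0 l.zero_mem
    have d₃ := hd₃.change 1 _ (l.neg_mem hab)
    rw [add_zero] at d₁ d₂
    have e : (1 : ℂ) • v₃ + -(v₃ - α • v₁ - β • v₂) = α • v₁ + β • v₂ := by module
    rw [e] at d₃
    obtain ⟨p, hpl, hp0, hp⟩ := special_position hl h0 (mul_ne_zero hα hk₁) (mul_ne_zero hβ hk₂)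
      (mul_ne_zero one_ne_zero hk₃) d₁ d₂ d₃
    obtain ⟨u, hu⟩ := exists_outside hl (α • v₁) (β • v₂)
    obtain ⟨A, B, D, hx, hDl, hDu⟩ := exists_coords hl (α • v₁) (β • v₂) u (by
      intro a b h
      rw [smul_smul, smul_smul] at h
      obtain ⟨ha, hb⟩ := i12 _ _ h
      exact ⟨(mul_eq_zero.1 ha).resolve_right hα, (mul_eq_zero.1 hb).resolve_right hβ⟩) hu
    refine n₂ (h₂ F S hS p D hp0 ?_ (hDl p hpl) ?_)
    · rintro rfl
      simp at hDu
    · intro x y hDx hDy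
      have ex := hx x
      have ey := hx y
      rw [hDx] at ex
      rw [hDy] at ey
      have := hp _ ex _ ey (A x) (B x) (A y) (B y)
      convert this using 1
      congr 1 <;> module


end
end

section
/- Let F = x·Q + λ₁₅·y²z + λ₁₆·yz² + λ₁₇·yzu + λ₁₈·yzv + λ₁₉·yv² + λ₂₀·zu² be a cubic form in five variables over ℂ, where Q is a homogeneous quadratic polynomial and λ₁₅, …, λ₂₀ ∈ ℂ. If F defines a smooth cubic threefold (i.e., the only common zero in ℂ⁵ of the five partial derivatives of F is the origin), then λ₁₉ ≠ 0 and λ₂₀ ≠ 0. (Otherwise V(F) would contain one of the 2-planes {x = z = 0} or {x = y = 0}, and hence would be singular.) -/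
open MvPolynomial

theorem quad_eval (Q : MvPolynomial (Fin 5) ℂ) (hQ : Q.IsHomogeneous 2) :
    ∃ M : Fin 5 → Fin 5 → ℂ, ∀ p, eval p Q = ∑ i, ∑ j, M i j * (p i * p j) := by
  have key : ∀ s : Finset (Fin 5 →₀ ℕ), (∀ d ∈ s, d.degree = 2) →
      ∃ M : Fin 5 → Fin 5 → ℂ, ∀ p : Fin 5 → ℂ,
        ∑ d ∈ s, Q.coeff d * (∏ i, p i ^ d i) = ∑ i, ∑ j, M i j * (p i * p j) := by
    intro s
    induction s using Finset.induction_on with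
    | empty => intro _; exact ⟨0, by simp⟩
    | insert d s hd ih =>
      intro h
      obtain ⟨M, hM⟩ := ih (fun e he => h e (Finset.mem_insert_of_mem he))
      have h2 := h d (Finset.mem_insert_self _ _)
      have hc : Multiset.card (Finsupp.toMultiset d) = 2 := by
        rw [Finsupp.card_toMultiset, ← h2]; rfl
      obtain ⟨a, b, hab⟩ := Multiset.card_eq_two.1 hc
      have hp : ∀ p : Fin 5 → ℂ, (∏ i, p i ^ d i) = p a * p b := by
        intro p
        have h3 := Finsupp.prod_toMultiset (d.mapDomain p)
        have h4 : (Finsupp.toMultiset d).map p = {p a, p b} := by rw [hab]; simp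
        have h5 : ((Finsupp.toMultiset d).map p).prod = ∏ i, p i ^ d i := by
          rw [Finsupp.toMultiset_map, Finsupp.prod_toMultiset,
            Finsupp.prod_mapDomain_index (by simp) (by intros; rw [pow_add]),
            Finsupp.prod_fintype _ _ (by simp)]
        rw [← h5, h4]; simp
      refine ⟨fun i j => M i j + if i = a ∧ j = b then Q.coeff d else 0, fun p => ?_⟩
      rw [Finset.sum_insert hd, hM, hp]
      simp [add_mul, Finset.sum_add_distrib, ite_and, add_comm]
  obtain ⟨M, hM⟩ := key Q.support (by
    intro d hd
    have := hQ (mem_support_iff.1 hd)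
    rwa [Finsupp.degree_eq_weight_one])
  exact ⟨M, fun p => by rw [eval_eq', hM]⟩

theorem quad_root (a b c : ℂ) (ha : a ≠ 0) : ∃ s : ℂ, a * s ^ 2 + b * s + c = 0 := by
  obtain ⟨s, hs⟩ := IsAlgClosed.exists_root
    (Polynomial.C a * Polynomial.X ^ 2 + Polynomial.C b * Polynomial.X + Polynomial.C c)
    (by rw [Polynomial.degree_quadratic ha]; decide)
  exact ⟨s, by simpa using hs⟩

theorem quartic_root (a b c d e : ℂ) (ha : a ≠ 0) :
    ∃ s : ℂ, a * s ^ 4 + b * s ^ 3 + c * s ^ 2 + d * s + e = 0 := by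
  obtain ⟨s, hs⟩ := IsAlgClosed.exists_root
    (Polynomial.C a * Polynomial.X ^ 4 + Polynomial.C b * Polynomial.X ^ 3 +
      Polynomial.C c * Polynomial.X ^ 2 + Polynomial.C d * Polynomial.X + Polynomial.C e)
    (by
      have : (Polynomial.C a * Polynomial.X ^ 4 + Polynomial.C b * Polynomial.X ^ 3 +
        Polynomial.C c * Polynomial.X ^ 2 + Polynomial.C d * Polynomial.X +
        Polynomial.C e).degree = 4 := by compute_degree!
      rw [this]; decide)
  exact ⟨s, by simpa using hs⟩

/-- Binary quadratic forms have nontrivial zeros. -/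
theorem binary_zero (a b c : ℂ) :
    ∃ s t : ℂ, (s ≠ 0 ∨ t ≠ 0) ∧ a * s ^ 2 + b * (s * t) + c * t ^ 2 = 0 := by
  by_cases ha : a = 0
  · exact ⟨1, 0, by simp, by simp [ha]⟩
  · obtain ⟨s, hs⟩ := quad_root a b c ha
    exact ⟨s, 1, by simp, by linear_combination hs⟩

/-- Two plane conics meet, where the second one passes through `(0,0,1)`. -/
theorem conics_meet (a b c d A B D E G H : ℂ) :
    ∃ y u v : ℂ, (y ≠ 0 ∨ u ≠ 0 ∨ v ≠ 0) ∧
      a * y ^ 2 + b * (y * u) + c * (y * v) + d * u ^ 2 = 0 ∧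
      A * y ^ 2 + B * u ^ 2 + D * v ^ 2 + E * (y * u) + G * (y * v) + H * (u * v) = 0 := by
  by_cases hD : D = 0
  · exact ⟨0, 0, 1, by simp, by simp, by simp [hD]⟩
  by_cases hd : d = 0
  · obtain ⟨s, t, h, h'⟩ := binary_zero B H D
    exact ⟨0, s, t, Or.inr h, by simp [hd], by linear_combination h'⟩
  by_cases hc : c = 0
  · obtain ⟨y, u, h, h'⟩ := binary_zero a b d
    obtain ⟨v, hv⟩ := quad_root D (G * y + H * u) (A * y ^ 2 + B * u ^ 2 + E * (y * u)) hD
    exact ⟨y, u, v, by tauto, by rw [hc]; linear_combination h', by linear_combination hv⟩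
  · obtain ⟨s, hs⟩ := quartic_root (D * d ^ 2) (2 * D * d * b - H * c * d)
      (B * c ^ 2 + D * (b ^ 2 + 2 * d * a) - G * c * d - H * c * b)
      (2 * D * a * b + E * c ^ 2 - G * c * b - H * c * a)
      (A * c ^ 2 + D * a ^ 2 - G * c * a) (by positivity)
    exact ⟨c, c * s, -(a + b * s + d * s ^ 2), Or.inl hc, by ring,
      by linear_combination hs⟩

/-- If the cubic form `F = x·Q + λ₁₅·y²z + λ₁₆·yz² + λ₁₇·yzu + λ₁₈·yzv + λ₁₉·yv²
+ λ₂₀·zu²` (with `Q` a homogeneous quadratic) defines a smooth cubic threefold,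
then `λ₁₉ ≠ 0` and `λ₂₀ ≠ 0`. Here `x = X 0`, `y = X 1`, `z = X 2`, `u = X 3`,
`v = X 4`. -/
theorem smooth_normal_form_coefficients_nonzero
    (Q : MvPolynomial (Fin 5) ℂ) (hQ : Q.IsHomogeneous 2)
    (l15 l16 l17 l18 l19 l20 : ℂ) (F : MvPolynomial (Fin 5) ℂ)
    (hF : F = X 0 * Q + C l15 * (X 1 ^ 2 * X 2) + C l16 * (X 1 * X 2 ^ 2) +
      C l17 * (X 1 * X 2 * X 3) + C l18 * (X 1 * X 2 * X 4) +
      C l19 * (X 1 * X 4 ^ 2) + C l20 * (X 2 * X 3 ^ 2))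
    (hsm : IsSmoothCubic F) :
    l19 ≠ 0 ∧ l20 ≠ 0 := by
  obtain ⟨M, hM⟩ := quad_eval Q hQ
  constructor
  · rintro rfl
    obtain ⟨y, u, v, h0, h1, h2⟩ := conics_meet l15 l17 l18 l20 (M 1 1) (M 3 3) (M 4 4)
      (M 1 3 + M 3 1) (M 1 4 + M 4 1) (M 3 4 + M 4 3)
    have hq : eval ![0, y, 0, u, v] Q = 0 := by
      rw [hM]
      simp [Fin.sum_univ_five]
      linear_combination h2
    have hp := hsm ![0, y, 0, u, v] (by
      intro i
      subst hF
      fin_cases i <;> simp [pderiv_X, hq, Pi.single_apply]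
      linear_combination h1)
    have e1 := congrFun hp 1
    have e3 := congrFun hp 3
    have e4 := congrFun hp 4
    simp at e1 e3 e4
    tauto
  · rintro rfl
    obtain ⟨z, v, u, h0, h1, h2⟩ := conics_meet l16 l18 l17 l19 (M 2 2) (M 4 4) (M 3 3)
      (M 2 4 + M 4 2) (M 2 3 + M 3 2) (M 3 4 + M 4 3)
    have hq : eval ![0, 0, z, u, v] Q = 0 := by
      rw [hM]
      simp [Fin.sum_univ_five]
      linear_combination h2
    have hp := hsm ![0, 0, z, u, v] (by
      intro i
      subst hF
      fin_cases i <;> simp [pderiv_X, hq, Pi.single_apply]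
      linear_combination h1)
    have e1 := congrFun hp 2
    have e3 := congrFun hp 3
    have e4 := congrFun hp 4
    simp at e1 e3 e4
    tauto
end

section
/- Let λ₀, …, λ₂₀ ∈ ℂ and let F be the cubic form F = x·(λ₀x² + λ₁xy + λ₂xz + λ₃xu + λ₄xv + λ₅y² + λ₆yz + λ₇yu + λ₈yv + λ₉z² + λ₁₀zu + λ₁₁zv + λ₁₂u² + λ₁₃uv + λ₁₄v²) + λ₁₅y²z + λ₁₆yz² + λ₁₇yzu + λ₁₈yzv + λ₁₉yv² + λ₂₀zu² in the variables x, y, z, u, v. Let R = ℂ[ε]/(ε²), and for (x′, y′, z′, x″, y″, z″) ∈ ℂ⁶ consider the R-points p = (εx′, εy′, εz′, 1, 0) and q = (εx″, εy″, εz″, 0, 1) of R⁵. Then F(s·p + t·q) = 0 as an element of the polynomial ring R[s,t] if and only if the four linear equations λ₁₂x′ + λ₂₀z′ = 0, λ₁₃x′ + λ₁₂x″ + λ₂₀z″ = 0, λ₁₄x′ + λ₁₃x″ + λ₁₉y′ = 0, and λ₁₄x″ + λ₁₉y″ = 0 hold. (This computes the tangent space at the line l : x = y = z = 0 of the variety of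 lines on the cubic threefold V(F).) -/
open MvPolynomial

noncomputable section

/-- The general cubic form `F = x·(λ₀x² + ⋯ + λ₁₄v²) + λ₁₅y²z + λ₁₆yz² + λ₁₇yzu +
λ₁₈yzv + λ₁₉yv² + λ₂₀zu²` through the configuration `l, r₁, r₂, π₁, π₂`.
Here `x = X 0`, `y = X 1`, `z = X 2`, `u = X 3`, `v = X 4`. -/
def cubicF (l : Fin 21 → ℂ) : MvPolynomial (Fin 5) ℂ :=
  X 0 * (C (l 0) * X 0 ^ 2 + C (l 1) * (X 0 * X 1) + C (l 2) * (X 0 * X 2) +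
    C (l 3) * (X 0 * X 3) + C (l 4) * (X 0 * X 4) + C (l 5) * X 1 ^ 2 +
    C (l 6) * (X 1 * X 2) + C (l 7) * (X 1 * X 3) + C (l 8) * (X 1 * X 4) +
    C (l 9) * X 2 ^ 2 + C (l 10) * (X 2 * X 3) + C (l 11) * (X 2 * X 4) +
    C (l 12) * X 3 ^ 2 + C (l 13) * (X 3 * X 4) + C (l 14) * X 4 ^ 2) +
  C (l 15) * (X 1 ^ 2 * X 2) + C (l 16) * (X 1 * X 2 ^ 2) +
  C (l 17) * (X 1 * X 2 * X 3) + C (l 18) * (X 1 * X 2 * X 4) +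
  C (l 19) * (X 1 * X 4 ^ 2) + C (l 20) * (X 2 * X 3 ^ 2)

theorem cubic_expand (S : Type*) [CommRing S] (l : Fin 21 → S) (e s t a b c a' b' c' : S)
    (he : e * e = 0) (x y z : S) (hx : x = s * (e * a) + t * (e * a'))
    (hy : y = s * (e * b) + t * (e * b')) (hz : z = s * (e * c) + t * (e * c')) :
    x * (l 0 * x ^ 2 + l 1 * (x * y) + l 2 * (x * z) + l 3 * (x * s) + l 4 * (x * t) +
      l 5 * y ^ 2 + l 6 * (y * z) + l 7 * (y * s) + l 8 * (y * t) + l 9 * z ^ 2 +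
      l 10 * (z * s) + l 11 * (z * t) + l 12 * s ^ 2 + l 13 * (s * t) + l 14 * t ^ 2) +
      l 15 * (y ^ 2 * z) + l 16 * (y * z ^ 2) + l 17 * (y * z * s) + l 18 * (y * z * t) +
      l 19 * (y * t ^ 2) + l 20 * (z * s ^ 2) =
    e * ((l 12 * a + l 20 * c) * s ^ 3 + (l 13 * a + l 12 * a' + l 20 * c') * (s ^ 2 * t) +
      (l 14 * a + l 13 * a' + l 19 * b) * (s * t ^ 2) + (l 14 * a' + l 19 * b') * t ^ 3) := by
  have hm : ∀ p q : S, (s * (e * p) + t * (e * q)) = e * (s * p + t * q) := by intros; ring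
  rw [hm] at hx hy hz
  have hxx : x * x = 0 := by rw [hx]; linear_combination (s * a + t * a') ^ 2 * he
  have hyy : y * y = 0 := by rw [hy]; linear_combination (s * b + t * b') ^ 2 * he
  have hzz : z * z = 0 := by rw [hz]; linear_combination (s * c + t * c') ^ 2 * he
  have hxy : x * y = 0 := by
    rw [hx, hy]; linear_combination (s * a + t * a') * (s * b + t * b') * he
  have hxz : x * z = 0 := by
    rw [hx, hz]; linear_combination (s * a + t * a') * (s * c + t * c') * he
  have hyz : y * z = 0 := by
    rw [hy, hz]; linear_combination (s * b + t * b') * (s * c + t * c') * he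
  linear_combination (l 0 * x + l 1 * y + l 2 * z + l 3 * s + l 4 * t) * hxx +
    (l 5 * y + l 6 * z + l 7 * s + l 8 * t) * hxy + (l 9 * z + l 10 * s + l 11 * t) * hxz +
    (l 15 * y + l 16 * z + l 17 * s + l 18 * t) * hyz +
    (l 12 * s ^ 2 + l 13 * (s * t) + l 14 * t ^ 2) * hx + l 19 * t ^ 2 * hy + l 20 * s ^ 2 * hz

/-- First-order deformations of the line `l : x = y = z = 0` lying on the cubic
threefold `V(F)`: over the dual numbers `R = ℂ[ε]`, the `R`-line spanned by
`p = (εx′, εy′, εz′, 1, 0)` and `q = (εx″, εy″, εz″, 0, 1)` lies on `V(F)`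
(i.e. `F(s·p + t·q) = 0` in `R[s,t]`) if and only if the four linear equations
`λ₁₂x′ + λ₂₀z′ = 0`, `λ₁₃x′ + λ₁₂x″ + λ₂₀z″ = 0`, `λ₁₄x′ + λ₁₃x″ + λ₁₉y′ = 0`
and `λ₁₄x″ + λ₁₉y″ = 0` hold. -/
theorem tangent_space_at_line_l (l : Fin 21 → ℂ) (x' y' z' x'' y'' z'' : ℂ) :
    (MvPolynomial.aeval
        (fun i : Fin 5 =>
          (X 0 : MvPolynomial (Fin 2) (DualNumber ℂ)) *
              C (![DualNumber.eps * algebraMap ℂ (DualNumber ℂ) x',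
                  DualNumber.eps * algebraMap ℂ (DualNumber ℂ) y',
                  DualNumber.eps * algebraMap ℂ (DualNumber ℂ) z', 1, 0] i) +
            (X 1 : MvPolynomial (Fin 2) (DualNumber ℂ)) *
              C (![DualNumber.eps * algebraMap ℂ (DualNumber ℂ) x'',
                  DualNumber.eps * algebraMap ℂ (DualNumber ℂ) y'',
                  DualNumber.eps * algebraMap ℂ (DualNumber ℂ) z'', 0, 1] i))
        (cubicF l) = 0) ↔
    (l 12 * x' + l 20 * z' = 0 ∧
     l 13 * x' + l 12 * x'' + l 20 * z'' = 0 ∧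
     l 14 * x' + l 13 * x'' + l 19 * y' = 0 ∧
     l 14 * x'' + l 19 * y'' = 0) := by
  have hexp := cubic_expand (MvPolynomial (Fin 2) (DualNumber ℂ))
    (fun i => C (algebraMap ℂ (DualNumber ℂ) (l i))) (C DualNumber.eps) (X 0) (X 1)
    (C (algebraMap ℂ (DualNumber ℂ) x')) (C (algebraMap ℂ (DualNumber ℂ) y'))
    (C (algebraMap ℂ (DualNumber ℂ) z')) (C (algebraMap ℂ (DualNumber ℂ) x''))
    (C (algebraMap ℂ (DualNumber ℂ) y'')) (C (algebraMap ℂ (DualNumber ℂ) z''))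
    (by rw [← C_mul, DualNumber.eps_mul_eps, C_0]) _ _ _ rfl rfl rfl
  refine (Eq.congr_left (Eq.trans ?_ hexp)).trans ?_
  · clear hexp
    have hC : ∀ r : ℂ, algebraMap ℂ (MvPolynomial (Fin 2) (DualNumber ℂ)) r =
      C (algebraMap ℂ (DualNumber ℂ) r) := fun r => rfl
    simp only [cubicF, map_add, map_mul, map_pow, aeval_X, algHom_C, hC, Matrix.cons_val,
      C_1, C_0, mul_one, mul_zero, add_zero, zero_add]
  clear hexp
  simp only [← C_mul, ← C_add, ← map_mul, ← map_add]
  constructor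
  · intro h
    have ev : ∀ s t : ℂ, (l 12 * x' + l 20 * z') * s ^ 3 +
        (l 13 * x' + l 12 * x'' + l 20 * z'') * (s ^ 2 * t) +
        (l 14 * x' + l 13 * x'' + l 19 * y') * (s * t ^ 2) +
        (l 14 * x'' + l 19 * y'') * t ^ 3 = 0 := by
      intro s t
      have h2 := congrArg (MvPolynomial.eval ![algebraMap ℂ (DualNumber ℂ) s,
        algebraMap ℂ (DualNumber ℂ) t]) h
      simp only [eval_mul, eval_add, eval_C, eval_pow, eval_X, eval_zero, map_zero,
        Matrix.cons_val_zero, Matrix.cons_val_one, ← map_mul, ← map_add, ← map_pow] at h2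
      have h4 := congrArg TrivSqZeroExt.snd h2
      simpa [TrivSqZeroExt.algebraMap_eq_inl] using h4
    have e1 := ev 1 0
    have e2 := ev 0 1
    have e3 := ev 1 1
    have e4 := ev 1 (-1)
    refine ⟨?_, ?_, ?_, ?_⟩
    · linear_combination e1
    · linear_combination (e3 - e4) / 2 - e2
    · linear_combination (e3 + e4) / 2 - e1
    · linear_combination e2
  · rintro ⟨h1, h2, h3, h4⟩
    simp only [h1, h2, h3, h4, map_zero, zero_mul, add_zero, mul_zero]

end
end

section
/- Let λ₀, …, λ₂₀ ∈ ℂ and let F be the cubic form F = x·(λ₀x² + λ₁xy + λ₂xz + λ₃xu + λ₄xv + λ₅y² + λ₆yz + λ₇yu + λ₈yv + λ₉z² + λ₁₀zu + λ₁₁zv + λ₁₂u² + λ₁₃uv + λ₁₄v²) + λ₁₅y²z + λ₁₆yz² + λ₁₇yzu + λ₁₈yzv + λ₁₉yv² + λ₂₀zu² in the variables x, y, z, u, v. Let R = ℂ[ε]/(ε²), and for (a′, b′, c′, a″, b″, c″, ) ∈ ℂ⁶ consider the R-points p = (εa′, 1, εb′, 0, εc′) and q = (εa″, 0, εb″, 1,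 εc″) of R⁵. Then F(s·p + t·q) = 0 as an element of the polynomial ring R[s,t] if and only if the four linear equations λ₅a′ + λ₁₅b′ = 0, λ₇a′ + λ₅a″ + λ₁₇b′ + λ₁₅b″ = 0, λ₁₂a′ + λ₇a″ + λ₂₀b′ + λ₁₇b″ = 0, and λ₁₂a″ + λ₂₀b″ = 0 hold; in particular the condition is independent of c′ and c″. (This computes the tangent space at the line r₁ : x = z = v = 0 of the variety of lines on the cubic threefold V(F).) -/
open MvPolynomial

noncomputable section

/-- First-order deformations of the line `r₁ : x = z = v = 0` lying on the cubic
threefold `V(F)`: over the dual numbers `R = ℂ[ε]`, the `R`-line spanned by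
`p = (εa′, 1, εb′, 0, εc′)` and `q = (εa″, 0, εb″, 1, εc″)` lies on `V(F)`
(i.e. `F(s·p + t·q) = 0` in `R[s,t]`) if and only if the four linear equations
`λ₅a′ + λ₁₅b′ = 0`, `λ₇a′ + λ₅a″ + λ₁₇b′ + λ₁₅b″ = 0`,
`λ₁₂a′ + λ₇a″ + λ₂₀b′ + λ₁₇b″ = 0` and `λ₁₂a″ + λ₂₀b″ = 0` hold; in particular the
condition is independent of `c′` and `c″`. -/
theorem tangent_space_at_line_r1 (l : Fin 21 → ℂ) (a' b' c' a'' b'' c'' : ℂ) :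
    (MvPolynomial.aeval
        (fun i : Fin 5 =>
          (X 0 : MvPolynomial (Fin 2) (DualNumber ℂ)) *
              C (![DualNumber.eps * algebraMap ℂ (DualNumber ℂ) a', 1,
                  DualNumber.eps * algebraMap ℂ (DualNumber ℂ) b', 0,
                  DualNumber.eps * algebraMap ℂ (DualNumber ℂ) c'] i) +
            (X 1 : MvPolynomial (Fin 2) (DualNumber ℂ)) *
              C (![DualNumber.eps * algebraMap ℂ (DualNumber ℂ) a'', 0,
                  DualNumber.eps * algebraMap ℂ (DualNumber ℂ) b'', 1,
                  DualNumber.eps * algebraMap ℂ (DualNumber ℂ) c''] i))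
        (cubicF l) = 0) ↔
    (l 5 * a' + l 15 * b' = 0 ∧
     l 7 * a' + l 5 * a'' + l 17 * b' + l 15 * b'' = 0 ∧
     l 12 * a' + l 7 * a'' + l 20 * b' + l 17 * b'' = 0 ∧
     l 12 * a'' + l 20 * b'' = 0) := by
  have key : (MvPolynomial.aeval
        (fun i : Fin 5 =>
          (X 0 : MvPolynomial (Fin 2) (DualNumber ℂ)) *
              C (![DualNumber.eps * algebraMap ℂ (DualNumber ℂ) a', 1,
                  DualNumber.eps * algebraMap ℂ (DualNumber ℂ) b', 0,
                  DualNumber.eps * algebraMap ℂ (DualNumber ℂ) c'] i) +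
            (X 1 : MvPolynomial (Fin 2) (DualNumber ℂ)) *
              C (![DualNumber.eps * algebraMap ℂ (DualNumber ℂ) a'', 0,
                  DualNumber.eps * algebraMap ℂ (DualNumber ℂ) b'', 1,
                  DualNumber.eps * algebraMap ℂ (DualNumber ℂ) c''] i))
        (cubicF l)) =
      C DualNumber.eps *
       (C (algebraMap ℂ (DualNumber ℂ) (l 5 * a' + l 15 * b')) * X 0 ^ 3 +
        C (algebraMap ℂ (DualNumber ℂ)
          (l 7 * a' + l 5 * a'' + l 17 * b' + l 15 * b'')) * (X 0 ^ 2 * X 1) +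
        C (algebraMap ℂ (DualNumber ℂ)
          (l 12 * a' + l 7 * a'' + l 20 * b' + l 17 * b'')) * (X 0 * X 1 ^ 2) +
        C (algebraMap ℂ (DualNumber ℂ) (l 12 * a'' + l 20 * b'')) * X 1 ^ 3) := by
    have h2 : (C DualNumber.eps : MvPolynomial (Fin 2) (DualNumber ℂ)) ^ 2 = 0 := by
      rw [← map_pow, pow_two, DualNumber.eps_mul_eps, map_zero]
    have hC : ∀ r : ℂ, algebraMap ℂ (MvPolynomial (Fin 2) (DualNumber ℂ)) r =
        C (algebraMap ℂ (DualNumber ℂ) r) := fun r => rfl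
    simp only [cubicF, map_add, map_mul, map_pow, aeval_X, algHom_C, hC,
      Matrix.cons_val, map_one, map_zero]
    generalize (C DualNumber.eps : MvPolynomial (Fin 2) (DualNumber ℂ)) = e at h2 ⊢
    have h3 : e ^ 3 = 0 := by rw [pow_succ, h2, zero_mul]
    ring_nf
    simp only [h2, h3, zero_mul, mul_zero, add_zero, zero_add]
    try ring
  rw [key]
  constructor
  · intro h
    have ev : ∀ s t : ℂ, (l 5 * a' + l 15 * b') * s ^ 3 +
        (l 7 * a' + l 5 * a'' + l 17 * b' + l 15 * b'') * (s ^ 2 * t) +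
        (l 12 * a' + l 7 * a'' + l 20 * b' + l 17 * b'') * (s * t ^ 2) +
        (l 12 * a'' + l 20 * b'') * t ^ 3 = 0 := by
      intro s t
      have h1 := congrArg (MvPolynomial.eval
        ![algebraMap ℂ (DualNumber ℂ) s, algebraMap ℂ (DualNumber ℂ) t]) h
      simp only [map_add, map_mul, map_pow, eval_C, eval_X, Matrix.cons_val, map_zero] at h1
      simp only [← map_add, ← map_mul, ← map_pow] at h1
      have h4 := congrArg TrivSqZeroExt.snd h1
      simpa [TrivSqZeroExt.algebraMap_eq_inl] using h4
    have e1 := ev 1 0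
    have e2 := ev 0 1
    have e3 := ev 1 1
    have e4 := ev 1 (-1)
    refine ⟨?_, ?_, ?_, ?_⟩
    · linear_combination e1
    · linear_combination (e3 - e4) / 2 - e2
    · linear_combination (e3 + e4) / 2 - e1
    · linear_combination e2
  · rintro ⟨h1, h2, h3, h4⟩
    rw [h1, h2, h3, h4]
    simp

end
end
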